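/- Let (u_p)_{p>1} be a family of nodal solutions of (𝒫_p) satisfying conditions (A), (B) and the Morse index one hypothesis (M), and write u_p⁺ := max(u_p, 0), u_p⁻ := min(u_p, 0) and M_p := max_Ω u_p. Then, as p → +∞: p·∫_Ω (u_p⁺)^{p+1} dx / M_p² → 8π, p·∫_Ω |u_p⁻|^{p+1} dx / M_p² → 8π, p·∫_Ω (u_p⁺)^{p} dx / M_p → 8π, and p·∫_Ω |u_p⁻|^{p} dx / M_p → 8π (equivalently, ∫ over the rescaled nodal domains of |1 + z_p/p|^{p+1} and |1 + z_p/p|^{p} converge to ∫_{ℝ²} e^U = 8π). -/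

import Mathlib

open MeasureTheory Real Set Filter Topology Metric

noncomputable section

/-- The Euclidean plane. -/
abbrev R2 : Type := EuclideanSpace ℝ (Fin 2)

/-- The Laplacian: sum of the two pure second directional derivatives. -/
def lap (u : R2 → ℝ) (x : R2) : ℝ :=
  ∑ i : Fin 2,
    fderiv ℝ (fun y => fderiv ℝ u y (EuclideanSpace.single i 1)) x (EuclideanSpace.single i 1)

/-- Each point of ∂Ω has a neighborhood in which ∂Ω is the graph of a C^∞ function
(in suitable Euclidean coordinates). -/
def SmoothBoundary (Ω : Set R2) : Prop :=
  ∀ x ∈ frontier Ω, ∃ V : Set R2, IsOpen V ∧ x ∈ V ∧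
    ∃ (e : R2 ≃ᵢ R2) (g : ℝ → ℝ), ContDiff ℝ (⊤ : ℕ∞) g ∧
      frontier Ω ∩ V = {y | y ∈ V ∧ e y 1 = g (e y 0)}

/-- A (classical) solution of the Lane–Emden problem `(𝒫_p)` on Ω. -/
def IsSolution (Ω : Set R2) (p : ℝ) (u : R2 → ℝ) : Prop :=
  ContDiffOn ℝ 2 u Ω ∧ ContDiffOn ℝ 1 u (closure Ω) ∧
  (∀ x ∈ Ω, -lap u x = |u x| ^ (p - 1) * u x) ∧
  (∀ x ∈ frontier Ω, u x = 0)

/-- A nodal (sign-changing) function on Ω. -/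
def IsNodal (Ω : Set R2) (u : R2 → ℝ) : Prop :=
  (∃ x ∈ Ω, 0 < u x) ∧ ∃ x ∈ Ω, u x < 0

/-- The energy functional E_p. -/
def energy (Ω : Set R2) (p : ℝ) (u : R2 → ℝ) : ℝ :=
  (1 / 2) * ∫ x in Ω, ‖gradient u x‖ ^ 2 - (1 / (p + 1)) * ∫ x in Ω, |u x| ^ (p + 1)

/-- Condition (A): p·∫_Ω |∇u_p|² → 16πe. -/
def CondA (Ω : Set R2) (u : ℝ → R2 → ℝ) : Prop :=
  Tendsto (fun p : ℝ => p * ∫ x in Ω, ‖gradient (u p) x‖ ^ 2) atTop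
    (𝓝 (16 * π * Real.exp 1))

/-- Condition (B): p·(u_p(x_p⁺) + u_p(x_p⁻)) → K for some K ≥ 0. -/
def CondB (u : ℝ → R2 → ℝ) (xp xm : ℝ → R2) : Prop :=
  ∃ K : ℝ, 0 ≤ K ∧ Tendsto (fun p : ℝ => p * (u p (xp p) + u p (xm p))) atTop (𝓝 K)

/-- ε_p := (p·u_p(x_p⁺)^{p−1})^{−1/2}. -/
def eps (u : ℝ → R2 → ℝ) (xp : ℝ → R2) (p : ℝ) : ℝ :=
  1 / Real.sqrt (p * u p (xp p) ^ (p - 1))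

/-- The rescaling z_p of u_p around x_p⁺. -/
def zp (u : ℝ → R2 → ℝ) (xp : ℝ → R2) (p : ℝ) (x : R2) : ℝ :=
  (p / u p (xp p)) * (u p (eps u xp p • x + xp p) - u p (xp p))

/-- The rescaling z_p⁻ of u_p around x_p⁻ (with the scale ε_p of the maximum). -/
def zm (u : ℝ → R2 → ℝ) (xp xm : ℝ → R2) (p : ℝ) (x : R2) : ℝ :=
  (p / u p (xp p)) * (-u p (eps u xp p • x + xm p) - u p (xp p))

/-- Convergence in C²_loc(ℝ²) of a family of functions f_i defined on sets D_i:
every compact set K is eventually contained in D_i, and on K all derivatives up to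
order 2 converge uniformly. -/
def TendstoC2loc {ι : Type} (l : Filter ι) (D : ι → Set R2) (f : ι → R2 → ℝ)
    (g : R2 → ℝ) : Prop :=
  ∀ K : Set R2, IsCompact K →
    (∀ᶠ i in l, K ⊆ D i) ∧
    ∀ n : ℕ, n ≤ 2 →
      TendstoUniformlyOn (fun i x => iteratedFDeriv ℝ n (f i) x)
        (fun x => iteratedFDeriv ℝ n g x) l K

/-- The standard bubble U(x) = −2 log(1 + |x|²/8). -/
def stdBubble (x : R2) : ℝ := -2 * Real.log (1 + ‖x‖ ^ 2 / 8)

/-- The bubble U_μ(x) = log(μ/(1 + μ|x|²/8)²). -/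
def bubble (μ : ℝ) (x : R2) : ℝ := Real.log (μ / (1 + μ * ‖x‖ ^ 2 / 8) ^ 2)

/-- A C^∞ function compactly supported in S. -/
def CcSmoothIn (S : Set R2) (v : R2 → ℝ) : Prop :=
  ContDiff ℝ (⊤ : ℕ∞) v ∧ HasCompactSupport v ∧ tsupport v ⊆ S

/-- The quadratic form of the linearized operator at u. -/
def Qform (p : ℝ) (u v : R2 → ℝ) : ℝ :=
  ∫ x, (‖gradient v x‖ ^ 2 - p * |u x| ^ (p - 1) * v x ^ 2)

/-- Morse index one hypothesis (M): for p large, the quadratic form of the linearized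
operator is negative somewhere on C_c^∞ of the positive nodal domain, but is not
negative definite on any 2-dimensional subspace. -/
def MorseOne (Ω : Set R2) (u : ℝ → R2 → ℝ) : Prop :=
  ∀ᶠ p : ℝ in atTop,
    (∃ v : R2 → ℝ, CcSmoothIn {x ∈ Ω | 0 < u p x} v ∧ Qform p (u p) v < 0) ∧
    ¬ ∃ v w : R2 → ℝ, CcSmoothIn {x ∈ Ω | 0 < u p x} v ∧
        CcSmoothIn {x ∈ Ω | 0 < u p x} w ∧
        LinearIndependent ℝ ![v, w] ∧
        ∀ a b : ℝ, ¬(a = 0 ∧ b = 0) →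
          Qform p (u p) (fun x => a * v x + b * w x) < 0

/-! ### Calculus in the plane -/

theorem inner_gradient_gradient (f g : R2 → ℝ) (x : R2) :
    inner ℝ (gradient f x) (gradient g x) =
      ∑ i : Fin 2, fderiv ℝ f x (EuclideanSpace.single i 1) *
        fderiv ℝ g x (EuclideanSpace.single i 1) := by
  rw [← (EuclideanSpace.basisFun (Fin 2) ℝ).sum_inner_mul_inner]
  refine Finset.sum_congr rfl fun i _ => ?_
  rw [EuclideanSpace.basisFun_apply, inner_gradient_left, real_inner_comm, inner_gradient_left]

theorem continuous_gradient {f : R2 → ℝ} (hf : ContDiff ℝ 1 f) : Continuous (gradient f) := by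
  have := hf.continuous_fderiv one_ne_zero
  exact (InnerProductSpace.toDual ℝ R2).symm.continuous.comp this

theorem HasCompactSupport.gradient {f : R2 → ℝ} (hf : HasCompactSupport f) :
    HasCompactSupport (gradient f) :=
  (hf.fderiv (𝕜 := ℝ)).comp_left (map_zero (InnerProductSpace.toDual ℝ R2).symm)

theorem gradient_eq_zero_of_notMem_tsupport {f : R2 → ℝ} {x : R2} (hx : x ∉ tsupport f) :
    gradient f x = 0 := by
  have : f =ᶠ[𝓝 x] fun _ => (0 : ℝ) := notMem_tsupport_iff_eventuallyEq.1 hx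
  rw [this.gradient_eq]
  simp

theorem contDiff_fderiv_apply {f : R2 → ℝ} (hf : ContDiff ℝ 2 f) (v : R2) :
    ContDiff ℝ 1 (fun y => fderiv ℝ f y v) :=
  (hf.fderiv_right (m := 1) (by norm_num)).clm_apply contDiff_const

theorem continuous_lap {f : R2 → ℝ} (hf : ContDiff ℝ 2 f) : Continuous (lap f) := by
  unfold lap
  refine continuous_finsetSum _ fun i _ => ?_
  exact ((contDiff_fderiv_apply hf _).continuous_fderiv one_ne_zero).clm_apply continuous_const

theorem lap_congr {f g : R2 → ℝ} {x : R2} (h : f =ᶠ[𝓝 x] g) : lap f x = lap g x := by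
  unfold lap
  refine Finset.sum_congr rfl fun i _ => ?_
  have : (fun y => fderiv ℝ f y (EuclideanSpace.single i 1)) =ᶠ[𝓝 x]
      fun y => fderiv ℝ g y (EuclideanSpace.single i 1) := by
    filter_upwards [h.fderiv (𝕜 := ℝ)] with y hy
    rw [hy]
  rw [this.fderiv_eq]

theorem lap_eq_zero_of_notMem_tsupport {f : R2 → ℝ} {x : R2} (hx : x ∉ tsupport f) :
    lap f x = 0 := by
  rw [lap_congr (notMem_tsupport_iff_eventuallyEq.1 hx : f =ᶠ[𝓝 x] fun _ => (0 : ℝ))]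
  simp [lap]

theorem lap_sub {f g : R2 → ℝ} (hf : ContDiff ℝ 2 f) (hg : ContDiff ℝ 2 g) (x : R2) :
    lap (f - g) x = lap f x - lap g x := by
  unfold lap
  rw [← Finset.sum_sub_distrib]
  refine Finset.sum_congr rfl fun i _ => ?_
  have : (fun y => fderiv ℝ (f - g) y (EuclideanSpace.single i 1)) =
      (fun y => fderiv ℝ f y (EuclideanSpace.single i 1)) -
        fun y => fderiv ℝ g y (EuclideanSpace.single i 1) := by
    ext y
    rw [fderiv_sub (hf.differentiable two_ne_zero y) (hg.differentiable two_ne_zero y)]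
    rfl
  rw [this, fderiv_sub ((contDiff_fderiv_apply hf _).differentiable one_ne_zero x)
    ((contDiff_fderiv_apply hg _).differentiable one_ne_zero x)]
  rfl

/-- Green's first identity on the plane for a compactly supported function. -/
theorem integral_inner_gradient {f g : R2 → ℝ} (hf : ContDiff ℝ 1 f) (hfc : HasCompactSupport f)
    (hg : ContDiff ℝ 2 g) :
    ∫ x, inner ℝ (gradient f x) (gradient g x) = -∫ x, f x * lap g x := by
  have hg1 : ContDiff ℝ 1 g := hg.of_le (by norm_num)
  simp only [inner_gradient_gradient, lap, Finset.mul_sum]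
  have hc1 : ∀ i : Fin 2, Integrable fun x => fderiv ℝ f x (EuclideanSpace.single i 1) *
      fderiv ℝ g x (EuclideanSpace.single i 1) := fun i =>
    (((hf.continuous_fderiv one_ne_zero).clm_apply continuous_const).mul
      ((hg1.continuous_fderiv one_ne_zero).clm_apply
        continuous_const)).integrable_of_hasCompactSupport
      (((hfc.fderiv (𝕜 := ℝ)).comp_left (g := fun L : R2 →L[ℝ] ℝ =>
        L (EuclideanSpace.single i 1)) rfl).mul_right)
  have hc2 : ∀ i : Fin 2, Integrable fun x => f x * fderiv ℝ
      (fun y => fderiv ℝ g y (EuclideanSpace.single i 1)) x (EuclideanSpace.single i 1) := fun i =>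
    (hf.continuous.mul (((contDiff_fderiv_apply hg _).continuous_fderiv one_ne_zero).clm_apply
      continuous_const)).integrable_of_hasCompactSupport hfc.mul_right
  rw [integral_finsetSum _ fun i _ => hc1 i, integral_finsetSum _ fun i _ => hc2 i,
    ← Finset.sum_neg_distrib]
  refine Finset.sum_congr rfl fun i _ => ?_
  rw [integral_mul_fderiv_eq_neg_fderiv_mul_of_integrable (hc1 i) (hc2 i), neg_neg]
  · exact (hf.continuous.mul ((hg1.continuous_fderiv one_ne_zero).clm_apply
      continuous_const)).integrable_of_hasCompactSupport hfc.mul_right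
  · exact fun x _ => hf.differentiable one_ne_zero x
  · exact fun x _ => (contDiff_fderiv_apply hg _).differentiable one_ne_zero x

theorem integral_mul_lap_comm {f g : R2 → ℝ} (hf : ContDiff ℝ 2 f) (hfc : HasCompactSupport f)
    (hg : ContDiff ℝ 2 g) :
    ∫ x, f x * lap g x = ∫ x, lap f x * g x := by
  have hf1 : ContDiff ℝ 1 f := hf.of_le (by norm_num)
  have hg1 : ContDiff ℝ 1 g := hg.of_le (by norm_num)
  have hd : ∀ {h : R2 → ℝ}, ContDiff ℝ 2 h → ∀ i : Fin 2, Differentiable ℝ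
      fun y => fderiv ℝ h y (EuclideanSpace.single i 1) := fun hh i =>
    (contDiff_fderiv_apply hh _).differentiable one_ne_zero
  have hs : ∀ i : Fin 2, HasCompactSupport fun y => fderiv ℝ f y (EuclideanSpace.single i 1) :=
    fun i => (hfc.fderiv (𝕜 := ℝ)).comp_left (g := fun L : R2 →L[ℝ] ℝ =>
        L (EuclideanSpace.single i 1)) rfl
  have hc2 : ∀ i : Fin 2, Integrable fun x => fderiv ℝ
      (fun y => fderiv ℝ f y (EuclideanSpace.single i 1)) x (EuclideanSpace.single i 1) * g x :=
    fun i => ((((contDiff_fderiv_apply hf _).continuous_fderiv one_ne_zero).clm_apply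
      continuous_const).mul hg.continuous).integrable_of_hasCompactSupport
      ((((hs i).fderiv (𝕜 := ℝ)).comp_left (g := fun L : R2 →L[ℝ] ℝ =>
        L (EuclideanSpace.single i 1)) rfl).mul_right)
  have hc1 : ∀ i : Fin 2, Integrable fun x => fderiv ℝ f x (EuclideanSpace.single i 1) *
      fderiv ℝ g x (EuclideanSpace.single i 1) := fun i =>
    (((hf1.continuous_fderiv one_ne_zero).clm_apply continuous_const).mul
      ((hg1.continuous_fderiv one_ne_zero).clm_apply
        continuous_const)).integrable_of_hasCompactSupport (hs i).mul_right
  rw [← neg_inj, ← integral_inner_gradient hf1 hfc hg]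
  simp only [inner_gradient_gradient, lap, Finset.sum_mul]
  rw [integral_finsetSum _ fun i _ => hc1 i, integral_finsetSum _ fun i _ => hc2 i,
    ← Finset.sum_neg_distrib]
  refine Finset.sum_congr rfl fun i _ => ?_
  rw [integral_mul_fderiv_eq_neg_fderiv_mul_of_integrable (hc2 i) (hc1 i)]
  · exact ((hd hf i).continuous.mul hg.continuous).integrable_of_hasCompactSupport
      (hs i).mul_right
  · exact fun x _ => hd hf i x
  · exact fun x _ => hg.differentiable two_ne_zero x

/-- The regularized logarithmic potential centred at `x₀`. -/
def logPot (s : ℝ) (x₀ y : R2) : ℝ := -(1 / (4 * π)) * log (‖y - x₀‖ ^ 2 + s)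

/-- The probability density `-Δ (logPot s x₀)`. -/
def logKer (s : ℝ) (x₀ y : R2) : ℝ := s / π / (‖y - x₀‖ ^ 2 + s) ^ 2

theorem contDiff_logPot {s : ℝ} (hs : 0 < s) (x₀ : R2) {n : ℕ∞} :
    ContDiff ℝ n (logPot s x₀) := by
  unfold logPot
  refine contDiff_const.mul (ContDiff.log ?_ fun y => by positivity)
  exact (contDiff_id.sub contDiff_const).norm_sq ℝ |>.add contDiff_const

theorem hasFDerivAt_norm_sub_sq_add (s : ℝ) (x₀ y : R2) :
    HasFDerivAt (fun y : R2 => ‖y - x₀‖ ^ 2 + s) (2 • innerSL ℝ (y - x₀)) y := by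
  have := (((hasFDerivAt_id (𝕜 := ℝ) y).sub_const x₀).norm_sq).add_const s
  simpa using this

theorem hasGradientAt_logPot {s : ℝ} (hs : 0 < s) (x₀ y : R2) :
    HasGradientAt (logPot s x₀) (-(1 / (2 * π) / (‖y - x₀‖ ^ 2 + s)) • (y - x₀)) y := by
  have h := ((hasFDerivAt_norm_sub_sq_add s x₀ y).log (by positivity)).const_mul (-(1 / (4 * π)))
  rw [hasGradientAt_iff_hasFDerivAt]
  refine h.congr_fderiv ?_
  ext v
  have : 0 < ‖y - x₀‖ ^ 2 + s := by positivity
  simp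
  field_simp
  ring

theorem gradient_logPot {s : ℝ} (hs : 0 < s) (x₀ y : R2) :
    gradient (logPot s x₀) y = -(1 / (2 * π) / (‖y - x₀‖ ^ 2 + s)) • (y - x₀) :=
  (hasGradientAt_logPot hs x₀ y).gradient

theorem norm_gradient_logPot {s : ℝ} (hs : 0 < s) (x₀ y : R2) :
    ‖gradient (logPot s x₀) y‖ = 1 / (2 * π) / (‖y - x₀‖ ^ 2 + s) * ‖y - x₀‖ := by
  rw [gradient_logPot hs, norm_smul, norm_neg, Real.norm_of_nonneg (by positivity)]

theorem lap_logPot {s : ℝ} (hs : 0 < s) (x₀ y : R2) :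
    lap (logPot s x₀) y = -logKer s x₀ y := by
  have h1 : ∀ i : Fin 2, (fun z => fderiv ℝ (logPot s x₀) z (EuclideanSpace.single i 1)) =
      fun z => -(1 / (2 * π)) * ((z i - x₀ i) / (‖z - x₀‖ ^ 2 + s)) := by
    intro i
    ext z
    rw [(hasGradientAt_logPot hs x₀ z).fderiv_apply, inner_smul_left, EuclideanSpace.inner_single_right]
    simp
    ring
  have h2 : ∀ i : Fin 2, fderiv ℝ (fun z : R2 => -(1 / (2 * π)) *
      ((z i - x₀ i) / (‖z - x₀‖ ^ 2 + s))) y (EuclideanSpace.single i 1) =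
      -(1 / (2 * π)) * (1 / (‖y - x₀‖ ^ 2 + s) -
        2 * (y i - x₀ i) ^ 2 / (‖y - x₀‖ ^ 2 + s) ^ 2) := by
    intro i
    have hp : HasFDerivAt (fun z : R2 => z i - x₀ i)
        (EuclideanSpace.proj i : R2 →L[ℝ] ℝ) y :=
      (EuclideanSpace.proj i : R2 →L[ℝ] ℝ).hasFDerivAt.sub_const _
    have hq := hasFDerivAt_norm_sub_sq_add s x₀ y
    have hne : ‖y - x₀‖ ^ 2 + s ≠ 0 := by positivity
    have hi := (hasDerivAt_inv hne).comp_hasFDerivAt y hq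
    simp only [div_eq_mul_inv (_ - _)]
    have hm : HasFDerivAt (fun z : R2 => -(1 / (2 * π)) *
        ((z i - x₀ i) * (‖z - x₀‖ ^ 2 + s)⁻¹)) _ y := (hp.mul hi).const_mul _
    rw [hm.fderiv]
    simp [EuclideanSpace.inner_single_right]
    field_simp
    ring
  unfold lap logKer
  simp_rw [h1, h2]
  have h3 : ‖y - x₀‖ ^ 2 = (y 0 - x₀ 0) ^ 2 + (y 1 - x₀ 1) ^ 2 := by
    rw [EuclideanSpace.norm_sq_eq]
    simp
  have hne : (y 0 - x₀ 0) ^ 2 + (y 1 - x₀ 1) ^ 2 + s ≠ 0 := by positivity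
  rw [Fin.sum_univ_two, h3]
  field_simp
  ring

/-! ### Radial integrals -/

theorem setIntegral_ball_norm_sub (g : ℝ → ℝ) (x₀ : R2) {D : ℝ} (hD : 0 ≤ D) :
    ∫ y in ball x₀ D, g ‖y - x₀‖ = 2 * π * ∫ r in (0 : ℝ)..D, r * g r := by
  have h1 : ∫ y in ball x₀ D, g ‖y - x₀‖ = ∫ y : R2, (Iio D).indicator g ‖y - x₀‖ := by
    rw [← integral_indicator measurableSet_ball]
    simp [indicator, dist_eq_norm]
  have h2 : volume.real (ball (0 : R2) 1) = π := by
    simp [Measure.real, pi_nonneg]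
  rw [h1, integral_sub_right_eq_self (fun y : R2 => (Iio D).indicator g ‖y‖) x₀,
    integral_fun_norm_addHaar, h2, intervalIntegral.integral_of_le hD, ← integral_Ioc_eq_integral_Ioo.symm]
  have h3 : ∀ y : ℝ, y ^ (Module.finrank ℝ R2 - 1) • (Iio D).indicator g y =
      (Iio D).indicator (fun r => r * g r) y := by
    intro y
    by_cases hy : y < D <;> simp [hy]
  simp_rw [h3]
  rw [setIntegral_indicator measurableSet_Iio, Ioi_inter_Iio]
  simp
  ring

theorem continuous_norm_gradient_logPot {s : ℝ} (hs : 0 < s) (x₀ : R2) :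
    Continuous fun y => ‖gradient (logPot s x₀) y‖ :=
  (continuous_gradient (contDiff_logPot hs x₀ (n := 1))).norm

theorem hasDerivAt_log_sq_add {s : ℝ} (hs : 0 < s) (r : ℝ) :
    HasDerivAt (fun r : ℝ => log (r ^ 2 + s)) (2 * r / (r ^ 2 + s)) r := by
  have h := (((hasDerivAt_id r).fun_pow 2).add_const s).log (by positivity)
  simpa using h

theorem setIntegral_ball_inv_norm_sq_add {s : ℝ} (hs : 0 < s) (x₀ : R2) {D : ℝ} (hD : 0 ≤ D) :
    ∫ y in ball x₀ D, 1 / (‖y - x₀‖ ^ 2 + s) = π * log (1 + D ^ 2 / s) := by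
  rw [setIntegral_ball_norm_sub (fun r => 1 / (r ^ 2 + s)) x₀ hD]
  have : ∫ r in (0 : ℝ)..D, r * (1 / (r ^ 2 + s)) =
      1 / 2 * log (D ^ 2 + s) - 1 / 2 * log (0 ^ 2 + s) := by
    refine intervalIntegral.integral_eq_sub_of_hasDerivAt (f := fun r => 1 / 2 * log (r ^ 2 + s))
      (fun r _ => ?_) (Continuous.intervalIntegrable ?_ _ _)
    · refine ((hasDerivAt_log_sq_add hs r).const_mul (1 / 2)).congr_deriv ?_
      field_simp
    · exact continuous_id.mul (continuous_const.div (by fun_prop) fun r => by positivity)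
  rw [this, show 1 + D ^ 2 / s = (D ^ 2 + s) / s by field_simp; ring,
    log_div (by positivity) hs.ne']
  simp
  ring

theorem norm_gradient_logPot_sq_le {s : ℝ} (hs : 0 < s) (x₀ y : R2) :
    ‖gradient (logPot s x₀) y‖ ^ 2 ≤ 1 / (4 * π ^ 2) * (1 / (‖y - x₀‖ ^ 2 + s)) := by
  rw [norm_gradient_logPot hs]
  have hπ := pi_pos
  have : 1 / (4 * π ^ 2) * (1 / (‖y - x₀‖ ^ 2 + s)) -
      (1 / (2 * π) / (‖y - x₀‖ ^ 2 + s) * ‖y - x₀‖) ^ 2 =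
      1 / (4 * π ^ 2) * (s / (‖y - x₀‖ ^ 2 + s) ^ 2) := by
    have : 0 < ‖y - x₀‖ ^ 2 + s := by positivity
    field_simp
    ring
  have h2 : 0 ≤ 1 / (4 * π ^ 2) * (s / (‖y - x₀‖ ^ 2 + s) ^ 2) := by positivity
  linarith

theorem integrableOn_ball_of_continuous {f : R2 → ℝ} (hf : Continuous f) (x₀ : R2) (D : ℝ) :
    IntegrableOn f (ball x₀ D) :=
  (hf.continuousOn.integrableOn_compact (isCompact_closedBall x₀ D)).mono_set
    ball_subset_closedBall

theorem setIntegral_ball_norm_gradient_logPot_sq_le {s : ℝ} (hs : 0 < s) (x₀ : R2) {D : ℝ}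
    (hD : 0 ≤ D) :
    ∫ y in ball x₀ D, ‖gradient (logPot s x₀) y‖ ^ 2 ≤ 1 / (4 * π) * log (1 + D ^ 2 / s) := by
  have hc : Continuous fun y : R2 => 1 / (‖y - x₀‖ ^ 2 + s) :=
    continuous_const.div (by fun_prop) fun r => by positivity
  calc _ ≤ ∫ y in ball x₀ D, 1 / (4 * π ^ 2) * (1 / (‖y - x₀‖ ^ 2 + s)) :=
        setIntegral_mono (integrableOn_ball_of_continuous
          ((continuous_norm_gradient_logPot hs x₀).pow 2) _ _)
          (integrableOn_ball_of_continuous (continuous_const.mul hc) _ _)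
          fun y => norm_gradient_logPot_sq_le hs x₀ y
    _ = _ := by
        rw [integral_const_mul, setIntegral_ball_inv_norm_sq_add hs x₀ hD]
        have := pi_pos
        field_simp

theorem setIntegral_ball_rpow_le {s : ℝ} (hs : 0 < s) (x₀ : R2) {D : ℝ} (hD : 0 ≤ D) {b : ℝ}
    (hb : b < 1) :
    ∫ y in ball x₀ D, (‖y - x₀‖ ^ 2 + s) ^ (-b) ≤ π * (D ^ 2 + s) ^ (1 - b) / (1 - b) := by
  have hb' : 0 < 1 - b := by linarith
  rw [setIntegral_ball_norm_sub (fun r => (r ^ 2 + s) ^ (-b)) x₀ hD]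
  have : ∫ r in (0 : ℝ)..D, r * (r ^ 2 + s) ^ (-b) =
      1 / (2 * (1 - b)) * (D ^ 2 + s) ^ (1 - b) - 1 / (2 * (1 - b)) * (0 ^ 2 + s) ^ (1 - b) := by
    refine intervalIntegral.integral_eq_sub_of_hasDerivAt
      (f := fun r => 1 / (2 * (1 - b)) * (r ^ 2 + s) ^ (1 - b))
      (fun r _ => ?_) (Continuous.intervalIntegrable ?_ _ _)
    · have h := ((((hasDerivAt_id r).fun_pow 2).add_const s).rpow_const (p := 1 - b)
        (Or.inl (by simp only [id]; positivity))).const_mul (1 / (2 * (1 - b)))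
      refine h.congr_deriv ?_
      rw [show 1 - b - 1 = -b by ring]
      simp
      field_simp
    · exact continuous_id.mul (Continuous.rpow_const (by fun_prop) fun r => Or.inl (by positivity))
  rw [this]
  have h1 : 0 ≤ 1 / (2 * (1 - b)) * (0 ^ 2 + s) ^ (1 - b) := by positivity
  have h2 : π * (D ^ 2 + s) ^ (1 - b) / (1 - b) =
      2 * π * (1 / (2 * (1 - b)) * (D ^ 2 + s) ^ (1 - b)) := by field_simp
  rw [h2]
  have := pi_pos
  gcongr
  linarith

theorem setIntegral_ball_weight_le {s : ℝ} (hs : 0 < s) (x₀ : R2) {D : ℝ} (hD : 0 ≤ D) {b τ : ℝ}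
    (hb : 0 < b) (hτ : 0 < τ) :
    ∫ y in ball x₀ D, ‖gradient (logPot s x₀) y‖ ^ 2 / (1 + τ * (‖y - x₀‖ ^ 2 + s) ^ (-b)) ≤
      1 / (4 * π * b) * log (1 + (D ^ 2 + s) ^ b / τ) := by
  have hπ := pi_pos
  have hpos : ∀ r : ℝ, 0 < r ^ 2 + s := fun r => by positivity
  have hrc : ∀ c : ℝ, Continuous fun r : ℝ => (r ^ 2 + s) ^ c := fun c =>
    Continuous.rpow_const (by fun_prop) fun r => Or.inl (hpos r).ne'
  have hrp : ∀ c r : ℝ, 0 < (r ^ 2 + s) ^ c := fun c r => rpow_pos_of_pos (hpos r) c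
  have hc : Continuous fun r : ℝ => (r ^ 2 + s) ^ (b - 1) / ((r ^ 2 + s) ^ b + τ) :=
    (hrc _).div ((hrc b).add continuous_const) fun r => (add_pos (hrp b r) hτ).ne'
  have hle : ∀ y : R2, ‖gradient (logPot s x₀) y‖ ^ 2 / (1 + τ * (‖y - x₀‖ ^ 2 + s) ^ (-b)) ≤
      1 / (4 * π ^ 2) * ((‖y - x₀‖ ^ 2 + s) ^ (b - 1) / ((‖y - x₀‖ ^ 2 + s) ^ b + τ)) := by
    intro y
    have hy := hpos ‖y - x₀‖
    have hb1 := hrp b ‖y - x₀‖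
    calc _ ≤ 1 / (4 * π ^ 2) * (1 / (‖y - x₀‖ ^ 2 + s)) /
          (1 + τ * (‖y - x₀‖ ^ 2 + s) ^ (-b)) := by
          gcongr
          exact norm_gradient_logPot_sq_le hs x₀ y
      _ = _ := by
          rw [rpow_neg hy.le, rpow_sub_one hy.ne']
          field_simp
  calc _ ≤ ∫ y in ball x₀ D, 1 / (4 * π ^ 2) *
        ((‖y - x₀‖ ^ 2 + s) ^ (b - 1) / ((‖y - x₀‖ ^ 2 + s) ^ b + τ)) := by
        refine setIntegral_mono (integrableOn_ball_of_continuous ?_ _ _)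
          (integrableOn_ball_of_continuous (continuous_const.mul
            (hc.comp (continuous_norm.comp (continuous_id.sub continuous_const)))) _ _) hle
        refine ((continuous_norm_gradient_logPot hs x₀).pow 2).div
          (continuous_const.add (continuous_const.mul ((hrc (-b)).comp
            (continuous_norm.comp (continuous_id.sub continuous_const))))) fun y => ?_
        have := hrp (-b) ‖y - x₀‖
        exact (add_pos one_pos (mul_pos hτ this)).ne'
    _ = 1 / (4 * π ^ 2) * (2 * π * ∫ r in (0 : ℝ)..D,
          r * ((r ^ 2 + s) ^ (b - 1) / ((r ^ 2 + s) ^ b + τ))) := by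
        rw [integral_const_mul, setIntegral_ball_norm_sub
          (fun r => (r ^ 2 + s) ^ (b - 1) / ((r ^ 2 + s) ^ b + τ)) x₀ hD]
    _ = 1 / (4 * π ^ 2) * (2 * π * (1 / (2 * b) * log ((D ^ 2 + s) ^ b + τ) -
          1 / (2 * b) * log ((0 ^ 2 + s) ^ b + τ))) := by
        congr 2
        refine intervalIntegral.integral_eq_sub_of_hasDerivAt
          (f := fun r => 1 / (2 * b) * log ((r ^ 2 + s) ^ b + τ))
          (fun r _ => ?_) ((continuous_id.mul hc).intervalIntegrable _ _)
        have h := (((((hasDerivAt_id r).fun_pow 2).add_const s).rpow_const (p := b)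
          (Or.inl (by simp only [id]; positivity))).add_const τ).log
          (by simp only [id]; exact (add_pos (hrp b r) hτ).ne')
        refine (h.const_mul (1 / (2 * b))).congr_deriv ?_
        simp
        field_simp
    _ ≤ 1 / (4 * π ^ 2) * (2 * π * (1 / (2 * b) * log ((D ^ 2 + s) ^ b + τ) -
          1 / (2 * b) * log τ)) := by
        gcongr
        have := hrp b 0
        linarith
    _ = _ := by
        have := hrp b D
        rw [show 1 + (D ^ 2 + s) ^ b / τ = ((D ^ 2 + s) ^ b + τ) / τ by field_simp; ring,
          log_div (by positivity) hτ.ne']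
        field_simp

theorem mul_log_add_ge {D a : ℝ} (hD : 0 < D) (ha : 0 < a) :
    D ^ 2 * log (D ^ 2) ≤ (D ^ 2 + a) * log (D ^ 2 + a) - a * log a := by
  have h1 : log (D ^ 2) ≤ log (D ^ 2 + a) := log_le_log (by positivity) (by linarith)
  have h2 : log a ≤ log (D ^ 2 + a) := log_le_log ha (by nlinarith)
  nlinarith [mul_le_mul_of_nonneg_left h1 (sq_nonneg D), mul_le_mul_of_nonneg_left h2 ha.le]

theorem mul_log_add_le {D a : ℝ} (hD : 0 < D) (ha : 0 < a) :
    (D ^ 2 + a) * log (D ^ 2 + a) - a * log a ≤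
      D ^ 2 * log (D ^ 2) + a * (1 + log (1 + D ^ 2 / a)) := by
  have hD2 : 0 < D ^ 2 := by positivity
  have h1 : log (D ^ 2 + a) - log (D ^ 2) ≤ a / D ^ 2 := by
    rw [← log_div (by positivity) (by positivity)]
    have := log_le_sub_one_of_pos (x := (D ^ 2 + a) / D ^ 2) (by positivity)
    have e : (D ^ 2 + a) / D ^ 2 - 1 = a / D ^ 2 := by field_simp; ring
    linarith
  have h2 : log (1 + D ^ 2 / a) = log (D ^ 2 + a) - log a := by
    rw [← log_div (by positivity) (by positivity)]
    congr 1
    field_simp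
    ring
  rw [h2]
  have h3 := mul_le_mul_of_nonneg_left h1 hD2.le
  have e : D ^ 2 * (a / D ^ 2) = a := by field_simp
  nlinarith

theorem setIntegral_ball_logPot_sub_le {s t : ℝ} (hs : 0 < s) (ht : 0 < t) (x₀ : R2) {D : ℝ}
    (hD : 0 < D) :
    ∫ y in ball x₀ D, (logPot t x₀ y - logPot s x₀ y) ≤ s / 4 * (1 + log (1 + D ^ 2 / s)) := by
  have hπ := pi_pos
  have h0 : ∀ y, logPot t x₀ y - logPot s x₀ y =
      (fun r => 1 / (4 * π) * (log (r ^ 2 + s) - log (r ^ 2 + t))) ‖y - x₀‖ := fun y => by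
    simp only [logPot]
    ring
  simp_rw [h0]
  rw [setIntegral_ball_norm_sub
    (fun r => 1 / (4 * π) * (log (r ^ 2 + s) - log (r ^ 2 + t))) x₀ hD.le]
  have hd : ∀ {a : ℝ}, 0 < a → ∀ r : ℝ, HasDerivAt
      (fun r : ℝ => (r ^ 2 + a) * log (r ^ 2 + a)) (2 * r * log (r ^ 2 + a) + 2 * r) r := by
    intro a ha r
    have h1 : HasDerivAt (fun r : ℝ => r ^ 2 + a) (2 * r) r := by
      simpa using ((hasDerivAt_id r).fun_pow 2).add_const a
    refine (h1.fun_mul (hasDerivAt_log_sq_add ha r)).congr_deriv ?_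
    have : r ^ 2 + a ≠ 0 := by positivity
    field_simp
  have hc : ∀ {a : ℝ}, 0 < a → Continuous fun r : ℝ => log (r ^ 2 + a) := fun ha =>
    Continuous.log (by fun_prop) fun r => by positivity
  have : ∫ r in (0 : ℝ)..D, r * (1 / (4 * π) * (log (r ^ 2 + s) - log (r ^ 2 + t))) =
      1 / (8 * π) * ((D ^ 2 + s) * log (D ^ 2 + s) - (D ^ 2 + t) * log (D ^ 2 + t)) -
      1 / (8 * π) * ((0 ^ 2 + s) * log (0 ^ 2 + s) - (0 ^ 2 + t) * log (0 ^ 2 + t)) := by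
    refine intervalIntegral.integral_eq_sub_of_hasDerivAt
      (f := fun r => 1 / (8 * π) * ((r ^ 2 + s) * log (r ^ 2 + s) - (r ^ 2 + t) * log (r ^ 2 + t)))
      (fun r _ => ?_) (Continuous.intervalIntegrable ?_ _ _)
    · refine (((hd hs r).sub (hd ht r)).const_mul (1 / (8 * π))).congr_deriv ?_
      field_simp
      ring
    · exact continuous_id.mul (continuous_const.mul ((hc hs).sub (hc ht)))
  rw [this]
  have e : ∀ A B : ℝ, 2 * π * (1 / (8 * π) * A - 1 / (8 * π) * B) = (A - B) / 4 := by
    intro A B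
    field_simp
    ring
  rw [e]
  have h1 := mul_log_add_le hD hs
  have h2 := mul_log_add_ge hD ht
  simp only [ne_eq, OfNat.ofNat_ne_zero, not_false_eq_true, zero_pow, zero_add]
  linarith

theorem logKer_nonneg {s : ℝ} (hs : 0 < s) (x₀ y : R2) : 0 ≤ logKer s x₀ y := by
  have := pi_pos
  unfold logKer
  positivity

theorem continuous_logKer {s : ℝ} (hs : 0 < s) (x₀ : R2) : Continuous (logKer s x₀) :=
  continuous_const.div (by fun_prop) fun y => by positivity

theorem integral_unit_logKer : ∫ y : R2, 1 / π / (‖y‖ ^ 2 + 1) ^ 2 = 1 := by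
  have hπ := pi_pos
  have h2 : volume.real (ball (0 : R2) 1) = π := by
    simp [Measure.real, pi_nonneg]
  rw [integral_fun_norm_addHaar volume (fun r : ℝ => 1 / π / (r ^ 2 + 1) ^ 2), h2]
  have hd : ∀ r ∈ Ici (0 : ℝ), HasDerivAt (fun r : ℝ => -(1 / (2 * π)) * (r ^ 2 + 1)⁻¹)
      (r ^ (Module.finrank ℝ R2 - 1) • (1 / π / (r ^ 2 + 1) ^ 2)) r := by
    intro r _
    have h1 : HasDerivAt (fun r : ℝ => r ^ 2 + 1) (2 * r) r := by
      simpa using ((hasDerivAt_id r).fun_pow 2).add_const 1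
    refine ((h1.fun_inv (by positivity)).const_mul (-(1 / (2 * π)))).congr_deriv ?_
    simp
    field_simp
  rw [integral_Ioi_of_hasDerivAt_of_nonneg' hd (fun r (hr : 0 < r) => by positivity) (l := 0)]
  · simp
  · have h : Tendsto (fun r : ℝ => r ^ 2 + 1) atTop atTop :=
      tendsto_atTop_add_const_right _ _ (tendsto_pow_atTop two_ne_zero)
    simpa using (tendsto_inv_atTop_zero.comp h).const_mul (-(1 / (2 * π)))

theorem logKer_inv_sq {c : ℝ} (hc : 0 < c) (x₀ y : R2) :
    logKer (c ^ 2)⁻¹ x₀ y = c ^ 2 * (1 / π / (‖c • (x₀ - y)‖ ^ 2 + 1) ^ 2) := by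
  have hπ := pi_pos
  rw [logKer, norm_smul, norm_sub_rev x₀ y, Real.norm_of_nonneg hc.le]
  field_simp

theorem integral_logKer {s : ℝ} (hs : 0 < s) (x₀ : R2) : ∫ y, logKer s x₀ y = 1 := by
  have hc : 0 < (√s)⁻¹ := by positivity
  have hs' : s = (((√s)⁻¹) ^ 2)⁻¹ := by rw [inv_pow, inv_inv, sq_sqrt hs.le]
  rw [hs']
  simp_rw [logKer_inv_sq hc]
  rw [integral_const_mul, integral_sub_left_eq_self
    (fun y : R2 => 1 / π / (‖(√s)⁻¹ • y‖ ^ 2 + 1) ^ 2),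
    Measure.integral_comp_smul volume (fun y : R2 => 1 / π / (‖y‖ ^ 2 + 1) ^ 2),
    integral_unit_logKer]
  simp
  field_simp

theorem integrable_logKer {s : ℝ} (hs : 0 < s) (x₀ : R2) : Integrable (logKer s x₀) :=
  integrable_of_integral_eq_one (integral_logKer hs x₀)

theorem tendsto_integral_mul_logKer {f : R2 → ℝ} (hf : Continuous f) (hfc : HasCompactSupport f)
    (x₀ : R2) :
    Tendsto (fun c : ℝ => ∫ y, f y * logKer (c ^ 2)⁻¹ x₀ y) atTop (𝓝 (f x₀)) := by
  have hπ := pi_pos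
  have h := tendsto_integral_comp_smul_smul_of_integrable' (μ := (volume : Measure R2))
    (φ := fun y => 1 / π / (‖y‖ ^ 2 + 1) ^ 2) (fun y => by positivity) integral_unit_logKer
    ?_ (hf.integrable_of_hasCompactSupport hfc) (x₀ := x₀) hf.continuousAt
  · refine h.congr' ?_
    filter_upwards [eventually_gt_atTop 0] with c hc
    refine integral_congr_ae (.of_forall fun y => ?_)
    simp only [logKer_inv_sq hc, smul_eq_mul, finrank_euclideanSpace, Fintype.card_fin]
    ring
  · have h1 : Tendsto (fun y : R2 => 1 / π / ‖y‖ ^ 2) (Bornology.cobounded R2) (𝓝 0) :=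
      ((tendsto_pow_atTop two_ne_zero).comp tendsto_norm_cobounded_atTop).const_div_atTop (1 / π)
    refine squeeze_zero (fun y => by positivity) (fun y => ?_) h1
    rcases (norm_nonneg y).eq_or_lt with h0 | h0
    · simp [← h0]
    · simp only [finrank_euclideanSpace, Fintype.card_fin]
      rw [← mul_div_assoc, div_le_div_iff₀ (by positivity) (by positivity)]
      have : ‖y‖ ^ 2 * ‖y‖ ^ 2 ≤ (‖y‖ ^ 2 + 1) ^ 2 := by nlinarith [sq_nonneg ‖y‖]
      have h3 : (0 : ℝ) ≤ 1 / π := by positivity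
      nlinarith [mul_le_mul_of_nonneg_left this h3]

/-! ### Pointwise estimates through the logarithmic potential -/

theorem sq_integral_mul_le {α : Type*} [MeasurableSpace α] {μ : Measure α} {f g : α → ℝ}
    (hf : Integrable (fun x => f x ^ 2) μ) (hg : Integrable (fun x => g x ^ 2) μ)
    (hfg : Integrable (fun x => f x * g x) μ) :
    (∫ x, f x * g x ∂μ) ^ 2 ≤ (∫ x, f x ^ 2 ∂μ) * ∫ x, g x ^ 2 ∂μ := by
  have h : ∀ t : ℝ, 0 ≤ (∫ x, g x ^ 2 ∂μ) * (t * t) + (2 * ∫ x, f x * g x ∂μ) * t +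
      ∫ x, f x ^ 2 ∂μ := by
    intro t
    have h0 : 0 ≤ ∫ x, (f x + t * g x) ^ 2 ∂μ := integral_nonneg fun x => sq_nonneg _
    have e : ∀ x, (f x + t * g x) ^ 2 = f x ^ 2 + (2 * t) * (f x * g x) + t ^ 2 * g x ^ 2 :=
      fun x => by ring
    simp_rw [e] at h0
    have h1 : Integrable (fun x => f x ^ 2 + (2 * t) * (f x * g x)) μ := hf.add (hfg.const_mul _)
    rw [integral_add h1 (hg.const_mul _), integral_add hf (hfg.const_mul _), integral_const_mul,
      integral_const_mul] at h0
    linarith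
  have := discrim_le_zero h
  rw [discrim] at this
  nlinarith

theorem integral_mul_logKer {f : R2 → ℝ} (hf : ContDiff ℝ 1 f) (hfc : HasCompactSupport f)
    {s : ℝ} (hs : 0 < s) (x₀ : R2) :
    ∫ y, f y * logKer s x₀ y = ∫ y, inner ℝ (gradient f y) (gradient (logPot s x₀) y) := by
  rw [integral_inner_gradient hf hfc (contDiff_logPot hs x₀ (n := 2)), ← integral_neg]
  simp_rw [lap_logPot hs]
  simp

theorem integral_eq_setIntegral_of_tsupport_subset {f F : R2 → ℝ} {S : Set R2}
    (hS : tsupport f ⊆ S) (hF : ∀ x ∉ tsupport f, F x = 0) : ∫ x, F x = ∫ x in S, F x :=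
  (setIntegral_eq_integral_of_forall_compl_eq_zero fun x hx => hF x fun h => hx (hS h)).symm

theorem logPot_sub_nonneg {s t : ℝ} (ht : 0 < t) (hts : t ≤ s) (x₀ y : R2) :
    0 ≤ logPot t x₀ y - logPot s x₀ y := by
  have hπ := pi_pos
  have h : log (‖y - x₀‖ ^ 2 + t) ≤ log (‖y - x₀‖ ^ 2 + s) :=
    log_le_log (by positivity) (by linarith)
  have e : logPot t x₀ y - logPot s x₀ y =
      1 / (4 * π) * (log (‖y - x₀‖ ^ 2 + s) - log (‖y - x₀‖ ^ 2 + t)) := by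
    simp only [logPot]
    ring
  rw [e]
  exact mul_nonneg (by positivity) (by linarith)

/-- A one-sided bound on the Laplacian controls how far a point value exceeds
the average against `logKer`. -/
theorem le_integral_inner_gradient_logPot {f : R2 → ℝ} (hf : ContDiff ℝ 2 f)
    (hfc : HasCompactSupport f) {x₀ : R2} {D A s : ℝ} (hD : 0 < D) (hA : 0 ≤ A) (hs : 0 < s)
    (hsupp : tsupport f ⊆ ball x₀ D) (hlap : ∀ x, -lap f x ≤ A) :
    f x₀ ≤ (∫ y, inner ℝ (gradient f y) (gradient (logPot s x₀) y)) +
      A * (s / 4 * (1 + log (1 + D ^ 2 / s))) := by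
  have hf1 : ContDiff ℝ 1 f := hf.of_le (by norm_num)
  have key : ∀ t, 0 < t → t ≤ s → ∫ y, f y * logKer t x₀ y ≤
      (∫ y, inner ℝ (gradient f y) (gradient (logPot s x₀) y)) +
      A * (s / 4 * (1 + log (1 + D ^ 2 / s))) := by
    intro t ht hts
    have hGt := contDiff_logPot ht x₀ (n := 2)
    have hGs := contDiff_logPot hs x₀ (n := 2)
    have hint : ∀ {r : ℝ}, 0 < r → Integrable fun y => f y * logKer r x₀ y := fun hr =>
      (hf.continuous.mul (continuous_logKer hr x₀)).integrable_of_hasCompactSupport hfc.mul_right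
    have hcH : Continuous fun y => logPot t x₀ y - logPot s x₀ y :=
      hGt.continuous.sub hGs.continuous
    have h1 : (∫ y, f y * logKer t x₀ y) - ∫ y, f y * logKer s x₀ y =
        ∫ y, -lap f y * (logPot t x₀ y - logPot s x₀ y) := by
      have h2 := integral_mul_lap_comm hf hfc (g := logPot t x₀ - logPot s x₀) (hGt.sub hGs)
      have h3 : ∀ y, lap (logPot t x₀ - logPot s x₀) y = logKer s x₀ y - logKer t x₀ y := by
        intro y
        rw [lap_sub hGt hGs, lap_logPot ht, lap_logPot hs]
        ring
      have h4 : ∀ y, lap f y * (logPot t x₀ - logPot s x₀) y =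
          -(-lap f y * (logPot t x₀ y - logPot s x₀ y)) := fun y => by
        simp only [Pi.sub_apply]
        ring
      simp_rw [h4] at h2
      rw [integral_neg] at h2
      have h5 : ∀ y, f y * lap (logPot t x₀ - logPot s x₀) y =
          f y * logKer s x₀ y - f y * logKer t x₀ y := fun y => by rw [h3]; ring
      simp_rw [h5] at h2
      rw [integral_sub (hint hs) (hint ht)] at h2
      linarith
    have h2 : ∫ y, -lap f y * (logPot t x₀ y - logPot s x₀ y) ≤
        A * (s / 4 * (1 + log (1 + D ^ 2 / s))) := by
      have hz : ∀ y ∉ tsupport f, -lap f y * (logPot t x₀ y - logPot s x₀ y) = 0 :=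
        fun y hy => by rw [lap_eq_zero_of_notMem_tsupport hy, neg_zero, zero_mul]
      rw [integral_eq_setIntegral_of_tsupport_subset hsupp hz]
      calc _ ≤ ∫ y in ball x₀ D, A * (logPot t x₀ y - logPot s x₀ y) :=
            setIntegral_mono
              (integrableOn_ball_of_continuous ((continuous_lap hf).neg.mul hcH) _ _)
              (integrableOn_ball_of_continuous (continuous_const.mul hcH) _ _)
              fun y => mul_le_mul_of_nonneg_right (hlap y) (logPot_sub_nonneg ht hts x₀ y)
        _ ≤ _ := by
            rw [integral_const_mul]
            exact mul_le_mul_of_nonneg_left (setIntegral_ball_logPot_sub_le hs ht x₀ hD) hA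
    rw [← integral_mul_logKer hf1 hfc hs]
    linarith
  refine le_of_tendsto (tendsto_integral_mul_logKer hf.continuous hfc x₀) ?_
  have ht : Tendsto (fun c : ℝ => (c ^ 2)⁻¹) atTop (𝓝 0) :=
    tendsto_inv_atTop_zero.comp (tendsto_pow_atTop two_ne_zero)
  filter_upwards [eventually_gt_atTop 0, ht.eventually_le_const hs] with c hc hcs
  exact key _ (by positivity) hcs

theorem integrable_inner_gradient {f g : R2 → ℝ} (hf : ContDiff ℝ 1 f)
    (hfc : HasCompactSupport f) (hg : ContDiff ℝ 1 g) :
    Integrable fun y => inner ℝ (gradient f y) (gradient g y) :=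
  ((continuous_gradient hf).inner (continuous_gradient hg)).integrable_of_hasCompactSupport
    (hfc.gradient.mono fun y hy h0 => hy (by simp only [h0, inner_zero_left]))

theorem integrable_norm_gradient_sq {f : R2 → ℝ} (hf : ContDiff ℝ 1 f)
    (hfc : HasCompactSupport f) : Integrable fun y => ‖gradient f y‖ ^ 2 := by
  simpa only [real_inner_self_eq_norm_sq] using integrable_inner_gradient hf hfc hf

theorem norm_sub_sq_add_rpow_le {s b : ℝ} (hs : 0 < s) (hb : 0 < b) (x y : R2) :
    (‖y - x‖ ^ 2 + s) ^ (-b) ≤ s ^ (-b) :=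
  rpow_le_rpow_of_nonpos hs (by nlinarith [sq_nonneg ‖y - x‖]) (by linarith)

theorem sq_integral_mul_logKer_le {f : R2 → ℝ} (hf : ContDiff ℝ 1 f) (hfc : HasCompactSupport f)
    {x : R2} {D s b τ : ℝ} (hD : 0 ≤ D) (hs : 0 < s) (hb : 0 < b) (hτ : 0 < τ)
    (hsupp : tsupport f ⊆ ball x D) :
    (∫ y, f y * logKer s x y) ^ 2 ≤
      ((∫ y, ‖gradient f y‖ ^ 2) + τ * ∫ y, ‖gradient f y‖ ^ 2 * (‖y - x‖ ^ 2 + s) ^ (-b)) *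
      (1 / (4 * π * b) * log (1 + (D ^ 2 + s) ^ b / τ)) := by
  set k : R2 → ℝ := fun y => (‖y - x‖ ^ 2 + s) ^ (-b) with hk
  have hkc : Continuous k := Continuous.rpow_const (by fun_prop) fun y => Or.inl (by positivity)
  have hkp : ∀ y, 0 < k y := fun y => rpow_pos_of_pos (by positivity) _
  set w : R2 → ℝ := fun y => 1 + τ * k y with hw
  have hwp : ∀ y, 0 < w y := fun y => add_pos one_pos (mul_pos hτ (hkp y))
  have hwc : Continuous w := continuous_const.add (continuous_const.mul hkc)
  have hfg := (continuous_gradient hf).norm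
  have hGg := continuous_norm_gradient_logPot hs x
  have hG1 : ContDiff ℝ 1 (logPot s x) := contDiff_logPot hs x (n := 1)
  have hz : ∀ y ∉ tsupport f, gradient f y = 0 := fun y hy =>
    gradient_eq_zero_of_notMem_tsupport hy
  have h1 : |∫ y, f y * logKer s x y| ≤ ∫ y in ball x D,
      (‖gradient f y‖ * √(w y)) * (‖gradient (logPot s x) y‖ / √(w y)) := by
    rw [integral_mul_logKer hf hfc hs, integral_eq_setIntegral_of_tsupport_subset hsupp
      fun y hy => by rw [hz y hy, inner_zero_left]]
    refine (abs_integral_le_integral_abs).trans ?_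
    refine setIntegral_mono (integrable_inner_gradient hf hfc hG1).abs.integrableOn
      (integrableOn_ball_of_continuous ((hfg.mul hwc.sqrt).mul (hGg.div hwc.sqrt
        fun y => (sqrt_pos.2 (hwp y)).ne')) _ _) fun y => ?_
    have := sqrt_pos.2 (hwp y)
    calc _ ≤ ‖gradient f y‖ * ‖gradient (logPot s x) y‖ := abs_real_inner_le_norm _ _
      _ = _ := by field_simp
  have e1 : ∀ y, (‖gradient f y‖ * √(w y)) ^ 2 = ‖gradient f y‖ ^ 2 * w y := fun y => by
    rw [mul_pow, sq_sqrt (hwp y).le]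
  have e2 : ∀ y, (‖gradient (logPot s x) y‖ / √(w y)) ^ 2 =
      ‖gradient (logPot s x) y‖ ^ 2 / w y := fun y => by
    rw [div_pow, sq_sqrt (hwp y).le]
  have h2 : (∫ y in ball x D,
      (‖gradient f y‖ * √(w y)) * (‖gradient (logPot s x) y‖ / √(w y))) ^ 2 ≤
      (∫ y in ball x D, ‖gradient f y‖ ^ 2 * w y) *
      ∫ y in ball x D, ‖gradient (logPot s x) y‖ ^ 2 / w y := by
    simp_rw [← e1, ← e2]
    refine sq_integral_mul_le ?_ ?_ ?_
    · exact integrableOn_ball_of_continuous ((hfg.mul hwc.sqrt).pow 2) _ _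
    · exact integrableOn_ball_of_continuous ((hGg.div hwc.sqrt
        fun y => (sqrt_pos.2 (hwp y)).ne').pow 2) _ _
    · exact integrableOn_ball_of_continuous ((hfg.mul hwc.sqrt).mul (hGg.div hwc.sqrt
        fun y => (sqrt_pos.2 (hwp y)).ne')) _ _
  have h3 : ∫ y in ball x D, ‖gradient f y‖ ^ 2 * w y =
      (∫ y, ‖gradient f y‖ ^ 2) + τ * ∫ y, ‖gradient f y‖ ^ 2 * k y := by
    rw [← integral_eq_setIntegral_of_tsupport_subset hsupp fun y hy => by rw [hz y hy]; simp,
      ← integral_const_mul, ← integral_add (integrable_norm_gradient_sq hf hfc)]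
    · refine integral_congr_ae (.of_forall fun y => ?_)
      simp only [hw]
      ring
    · refine Continuous.integrable_of_hasCompactSupport (by fun_prop)
        (hfc.gradient.mono fun y hy h0 => hy ?_)
      simp only [h0, norm_zero]
      simp
  have h4 := setIntegral_ball_weight_le hs x hD hb hτ
  have h5 : 0 ≤ ∫ y in ball x D, ‖gradient f y‖ ^ 2 * w y :=
    integral_nonneg fun y => mul_nonneg (sq_nonneg _) (hwp y).le
  rw [← h3, ← sq_abs]
  calc _ ≤ _ := pow_le_pow_left₀ (abs_nonneg _) h1 2
    _ ≤ _ := h2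
    _ ≤ _ := mul_le_mul_of_nonneg_left h4 h5

theorem integrable_prod_norm_gradient_sq {f : R2 → ℝ} (hf : ContDiff ℝ 1 f)
    (hfc : HasCompactSupport f) {S : Set R2} (hSv : volume S ≠ ⊤) {s b : ℝ} (hs : 0 < s)
    (hb : 0 < b) :
    Integrable (fun z : R2 × R2 => ‖gradient f z.2‖ ^ 2 * (‖z.2 - z.1‖ ^ 2 + s) ^ (-b))
      ((volume.restrict S).prod volume) := by
  have : IsFiniteMeasure (volume.restrict S) := ⟨by simpa using hSv.lt_top⟩
  have h1 : Integrable (fun z : R2 × R2 => s ^ (-b) * ‖gradient f z.2‖ ^ 2)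
      ((volume.restrict S).prod volume) :=
    (integrable_const (s ^ (-b))).mul_prod (integrable_norm_gradient_sq hf hfc)
  have hc := continuous_gradient hf
  refine h1.mono' (Continuous.aestronglyMeasurable ?_) (.of_forall fun z => ?_)
  · exact ((hc.comp continuous_snd).norm.pow 2).mul
      (Continuous.rpow_const (by fun_prop) fun z => Or.inl (by positivity))
  · rw [Real.norm_of_nonneg (by positivity), mul_comm]
    exact mul_le_mul_of_nonneg_right (norm_sub_sq_add_rpow_le hs hb _ _) (sq_nonneg _)

theorem setIntegral_potential_le {f : R2 → ℝ} (hf : ContDiff ℝ 1 f)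
    (hfc : HasCompactSupport f) {S : Set R2} (hSv : volume S ≠ ⊤)
    {D s b : ℝ} (hD : 0 ≤ D) (hs : 0 < s) (hb : 0 < b) (hb1 : b < 1)
    (hSD : ∀ x ∈ S, S ⊆ ball x D) (hsupp : tsupport f ⊆ S) :
    ∫ x in S, ∫ y, ‖gradient f y‖ ^ 2 * (‖y - x‖ ^ 2 + s) ^ (-b) ≤
      (π * (D ^ 2 + s) ^ (1 - b) / (1 - b)) * ∫ y, ‖gradient f y‖ ^ 2 := by
  have : IsFiniteMeasure (volume.restrict S) := ⟨by simpa using hSv.lt_top⟩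
  have hI := integrable_prod_norm_gradient_sq hf hfc hSv hs hb
  rw [integral_integral_swap hI, ← integral_const_mul]
  refine integral_mono hI.integral_prod_right
    ((integrable_norm_gradient_sq hf hfc).const_mul _) fun y => ?_
  simp only
  rw [integral_const_mul, mul_comm]
  by_cases hy : y ∈ tsupport f
  · refine mul_le_mul_of_nonneg_right ?_ (sq_nonneg _)
    refine le_trans ?_ (setIntegral_ball_rpow_le hs y hD hb1)
    simp_rw [norm_sub_rev y]
    refine setIntegral_mono_set (integrableOn_ball_of_continuous (Continuous.rpow_const
      (by fun_prop) fun z => Or.inl (by positivity)) _ _) (.of_forall fun z => ?_)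
      (LE.le.eventuallyLE (hSD y (hsupp hy)))
    positivity
  · rw [gradient_eq_zero_of_notMem_tsupport hy]
    simp

theorem abs_rpow_le_mul_exp {t a q : ℝ} (ha : 0 < a) (hq : 0 < q) :
    |t| ^ q ≤ (q / (2 * exp 1 * a)) ^ (q / 2) * exp (a * t ^ 2) := by
  rcases eq_or_ne t 0 with rfl | ht
  · rw [abs_zero, zero_rpow hq.ne']
    positivity
  have ht' : 0 < |t| := abs_pos.2 ht
  have hr : (0 : ℝ) < q / (2 * exp 1 * a) := by positivity
  rw [rpow_def_of_pos ht', rpow_def_of_pos hr, ← exp_add, exp_le_exp]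
  have h1 := log_le_sub_one_of_pos (x := a * t ^ 2 / (q / 2)) (by positivity)
  have h2 : log (a * t ^ 2 / (q / 2)) = log a + 2 * log |t| - (log q - log 2) := by
    rw [log_div (by positivity) (by positivity), log_mul (by positivity) (by positivity),
      log_div (by positivity) (by positivity), ← sq_abs, log_pow]
    norm_num
  have h3 : log (q / (2 * exp 1 * a)) = log q - (log 2 + 1 + log a) := by
    rw [log_div (by positivity) (by positivity), log_mul (by positivity) (by positivity),
      log_mul (by positivity) (by positivity), log_exp]
  rw [h2] at h1
  rw [h3]
  have h4 := mul_le_mul_of_nonneg_left h1 (by positivity : (0 : ℝ) ≤ q / 2)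
  have h5 : q / 2 * (a * t ^ 2 / (q / 2) - 1) = a * t ^ 2 - q / 2 := by field_simp
  rw [h5] at h4
  linarith

/-- The constant in the subcritical Moser–Trudinger inequality. -/
def moserConst (S : Set R2) (D b η : ℝ) : ℝ :=
  volume.real S + (D ^ 2 + 1) ^ b / η *
    (π * (D ^ 2 + 1) ^ (1 - b) / (1 - b) + volume.real S)

/-- Subcritical Moser–Trudinger inequality, in `L^q` form and for mollified functions. -/
theorem setIntegral_abs_mollified_rpow_le {f : R2 → ℝ} (hf : ContDiff ℝ 1 f)
    (hfc : HasCompactSupport f) {S : Set R2} (hSm : MeasurableSet S) (hSv : volume S ≠ ⊤)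
    {D s b η J q : ℝ} (hD : 0 ≤ D) (hs : 0 < s) (hs1 : s ≤ 1) (hb : 0 < b) (hb1 : b < 1)
    (hη : 0 < η) (hq : 0 < q) (hSD : ∀ x ∈ S, S ⊆ ball x D) (hsupp : tsupport f ⊆ S)
    (hJ : 0 < J) (hfJ : ∫ y, ‖gradient f y‖ ^ 2 ≤ J) :
    ∫ x in S, |∫ y, f y * logKer s x y| ^ q ≤
      moserConst S D b η * (q * J / (2 * exp 1 * (4 * π * b / (1 + η)))) ^ (q / 2) := by
  have hπ := pi_pos
  have : IsFiniteMeasure (volume.restrict S) := ⟨by simpa using hSv.lt_top⟩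
  set a : ℝ := 4 * π * b / (1 + η) with ha
  have hap : 0 < a := by positivity
  set G : R2 → ℝ := fun x => ∫ y, ‖gradient f y‖ ^ 2 * (‖y - x‖ ^ 2 + s) ^ (-b) with hG
  have hG0 : ∀ x, 0 ≤ G x := fun x => integral_nonneg fun y => by positivity
  have hGi : IntegrableOn G S :=
    (integrable_prod_norm_gradient_sq hf hfc hSv hs hb).integral_prod_left
  set Q : ℝ := (q * J / (2 * exp 1 * a)) ^ (q / 2) with hQ
  have hQ0 : 0 < Q := by positivity
  have hDs : 0 < D ^ 2 + s := by positivity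
  have pt : ∀ x ∈ S, |∫ y, f y * logKer s x y| ^ q ≤
      Q * (1 + (D ^ 2 + s) ^ b / η * (G x / J + 1)) := by
    intro x hx
    set t := ∫ y, f y * logKer s x y with ht
    have hGJ : 0 < G x + J := by linarith [hG0 x]
    have h1 := sq_integral_mul_logKer_le hf hfc hD hs hb (τ := η * J / (G x + J)) (by positivity)
      (hsupp.trans (hSD x hx))
    have hlog : 0 ≤ log (1 + (D ^ 2 + s) ^ b / (η * J / (G x + J))) :=
      log_nonneg (by linarith [show 0 ≤ (D ^ 2 + s) ^ b / (η * J / (G x + J)) by positivity])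
    have h2 : (∫ y, ‖gradient f y‖ ^ 2) + η * J / (G x + J) * G x ≤ J * (1 + η) := by
      have : η * J / (G x + J) * G x ≤ η * J := by
        rw [div_mul_eq_mul_div, div_le_iff₀ hGJ]
        have : 0 ≤ η * J * J := by positivity
        linarith
      linarith
    have h3 : a / J * t ^ 2 ≤ log (1 + (D ^ 2 + s) ^ b / (η * J / (G x + J))) := by
      calc a / J * t ^ 2 ≤ a / J * ((J * (1 + η)) * (1 / (4 * π * b) *
            log (1 + (D ^ 2 + s) ^ b / (η * J / (G x + J))))) := by
            refine mul_le_mul_of_nonneg_left (h1.trans ?_) (by positivity)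
            exact mul_le_mul_of_nonneg_right h2 (by positivity)
        _ = _ := by
            rw [ha]
            field_simp
    have h4 : exp (a / J * t ^ 2) ≤ 1 + (D ^ 2 + s) ^ b / η * (G x / J + 1) := by
      refine (exp_le_exp.2 h3).trans_eq ?_
      rw [exp_log (by positivity)]
      field_simp
    have h5 := abs_rpow_le_mul_exp (t := t) (a := a / J) (by positivity) hq
    have h6 : q / (2 * exp 1 * (a / J)) = q * J / (2 * exp 1 * a) := by field_simp
    rw [h6] at h5
    exact h5.trans (mul_le_mul_of_nonneg_left h4 hQ0.le)
  have hi : IntegrableOn (fun x => G x / J + 1) S := (hGi.div_const J).add (integrable_const _)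
  have hRi : IntegrableOn (fun x => Q * (1 + (D ^ 2 + s) ^ b / η * (G x / J + 1))) S :=
    ((integrable_const _).add (hi.const_mul _)).const_mul _
  have hA : ∫ x in S, |∫ y, f y * logKer s x y| ^ q ≤
      ∫ x in S, Q * (1 + (D ^ 2 + s) ^ b / η * (G x / J + 1)) :=
    integral_mono_of_nonneg (.of_forall fun x => by positivity) hRi
      ((ae_restrict_iff' hSm).2 (.of_forall pt))
  refine hA.trans ?_
  have hB : ∫ x in S, Q * (1 + (D ^ 2 + s) ^ b / η * (G x / J + 1)) =
      Q * (volume.real S + (D ^ 2 + s) ^ b / η * ((∫ x in S, G x) / J + volume.real S)) := by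
    rw [integral_const_mul, integral_add (integrable_const _)
      (hi.const_mul _), integral_const_mul,
      integral_add (hGi.div_const J) (integrable_const _), integral_div]
    simp
  have hC : (∫ x in S, G x) / J ≤ π * (D ^ 2 + 1) ^ (1 - b) / (1 - b) := by
    rw [div_le_iff₀ hJ]
    have hb' : 0 < 1 - b := by linarith
    refine (setIntegral_potential_le hf hfc hSv hD hs hb hb1 hSD hsupp).trans ?_
    gcongr
  rw [hB, mul_comm, moserConst]
  gcongr

theorem abs_integral_mul_logKer_le {f : R2 → ℝ} {c s : ℝ} (hs : 0 < s) (hfc : ∀ y, |f y| ≤ c)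
    (x : R2) : |∫ y, f y * logKer s x y| ≤ c := by
  have h : ‖∫ y, f y * logKer s x y‖ ≤ ∫ y, c * logKer s x y :=
    norm_integral_le_of_norm_le ((integrable_logKer hs x).const_mul c) (.of_forall fun y => by
      rw [norm_mul, Real.norm_of_nonneg (logKer_nonneg hs x y)]
      exact mul_le_mul_of_nonneg_right (hfc y) (logKer_nonneg hs x y))
  rwa [integral_const_mul, integral_logKer hs, mul_one] at h

/-- Subcritical Moser–Trudinger inequality, in `L^q` form. -/
theorem setIntegral_abs_rpow_le {f : R2 → ℝ} (hf : ContDiff ℝ 1 f)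
    (hfc : HasCompactSupport f) {S : Set R2} (hSm : MeasurableSet S) (hSv : volume S ≠ ⊤)
    {D b η J q : ℝ} (hD : 0 ≤ D) (hb : 0 < b) (hb1 : b < 1)
    (hη : 0 < η) (hq : 0 < q) (hSD : ∀ x ∈ S, S ⊆ ball x D) (hsupp : tsupport f ⊆ S)
    (hJ : 0 < J) (hfJ : ∫ y, ‖gradient f y‖ ^ 2 ≤ J) :
    ∫ x in S, |f x| ^ q ≤
      moserConst S D b η * (q * J / (2 * exp 1 * (4 * π * b / (1 + η)))) ^ (q / 2) := by
  have : IsFiniteMeasure (volume.restrict S) := ⟨by simpa using hSv.lt_top⟩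
  obtain ⟨c, hc⟩ := hf.continuous.bounded_above_of_compact_support hfc
  have hc0 : 0 ≤ c := (norm_nonneg _).trans (hc 0)
  have hlim : Tendsto (fun r : ℝ => ∫ x in S, |∫ y, f y * logKer (r ^ 2)⁻¹ x y| ^ q) atTop
      (𝓝 (∫ x in S, |f x| ^ q)) := by
    refine tendsto_integral_filter_of_dominated_convergence (fun _ => c ^ q) ?_ ?_
      (integrable_const _) ?_
    · filter_upwards [eventually_gt_atTop 0] with r hr
      have h1 : Continuous fun z : R2 × R2 => f z.2 * logKer (r ^ 2)⁻¹ z.1 z.2 := by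
        unfold logKer
        exact (hf.continuous.comp continuous_snd).mul
          (continuous_const.div (by fun_prop) fun z => by positivity)
      have h2 : StronglyMeasurable fun x => ∫ y, f y * logKer (r ^ 2)⁻¹ x y :=
        h1.stronglyMeasurable.integral_prod_right
      exact (h2.measurable.abs.pow_const q).aestronglyMeasurable
    · filter_upwards [eventually_gt_atTop 0] with r hr
      refine .of_forall fun x => ?_
      rw [Real.norm_of_nonneg (by positivity)]
      exact rpow_le_rpow (abs_nonneg _) (abs_integral_mul_logKer_le (by positivity) hc x) hq.le
    · exact .of_forall fun x =>
        ((tendsto_integral_mul_logKer hf.continuous hfc x).abs).rpow_const (.inr hq.le)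
  refine le_of_tendsto hlim ?_
  filter_upwards [eventually_ge_atTop 1] with r hr
  exact setIntegral_abs_mollified_rpow_le hf hfc hSm hSv hD (by positivity)
    (inv_le_one_of_one_le₀ (one_le_pow₀ hr)) hb hb1 hη hq hSD hsupp hJ hfJ

/-! ### Smooth truncation of solutions -/

/-- A smooth cutoff vanishing on `(-∞, δ]` and equal to `1` on `[2δ, ∞)`. -/
def cut (δ t : ℝ) : ℝ := smoothTransition ((t - δ) / δ)

/-- A smooth approximation of the positive part `max t 0`. -/
def trunc (δ t : ℝ) : ℝ := ∫ s in (0 : ℝ)..t, cut δ s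

theorem contDiff_cut (δ : ℝ) {n : ℕ∞} : ContDiff ℝ n (cut δ) :=
  smoothTransition.contDiff.comp ((contDiff_id.sub contDiff_const).div_const δ)

theorem cut_nonneg (δ t : ℝ) : 0 ≤ cut δ t := smoothTransition.nonneg _

theorem cut_le_one (δ t : ℝ) : cut δ t ≤ 1 := smoothTransition.le_one _

theorem cut_eq_zero {δ t : ℝ} (hδ : 0 < δ) (ht : t ≤ δ) : cut δ t = 0 :=
  smoothTransition.zero_of_nonpos (div_nonpos_of_nonpos_of_nonneg (by linarith) hδ.le)

theorem cut_eq_one {δ t : ℝ} (hδ : 0 < δ) (ht : 2 * δ ≤ t) : cut δ t = 1 :=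
  smoothTransition.one_of_one_le (by rw [le_div_iff₀ hδ]; linarith)

theorem monotone_cut {δ : ℝ} (hδ : 0 < δ) : Monotone (cut δ) := fun s t hst =>
  smoothTransition.monotone (by gcongr)

theorem hasDerivAt_trunc (δ t : ℝ) : HasDerivAt (trunc δ) (cut δ t) t := by
  have hc : Continuous (cut δ) := (contDiff_cut δ (n := 0)).continuous
  exact (hc.integral_hasStrictDerivAt 0 t).hasDerivAt

theorem deriv_trunc (δ : ℝ) : deriv (trunc δ) = cut δ :=
  funext fun t => (hasDerivAt_trunc δ t).deriv

theorem contDiff_trunc (δ : ℝ) : ContDiff ℝ 2 (trunc δ) := by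
  rw [show (2 : WithTop ℕ∞) = 1 + 1 by norm_num, contDiff_succ_iff_deriv]
  refine ⟨fun t => (hasDerivAt_trunc δ t).differentiableAt, by simp, ?_⟩
  rw [deriv_trunc]
  exact contDiff_cut δ (n := 1)

theorem trunc_eq_zero {δ t : ℝ} (hδ : 0 < δ) (ht : t ≤ δ) : trunc δ t = 0 := by
  rw [trunc, intervalIntegral.integral_zero_ae]
  refine .of_forall fun s hs => cut_eq_zero hδ ?_
  rcases mem_uIoc.1 hs with h | h <;> linarith [h.1, h.2]

theorem monotone_trunc (δ : ℝ) : Monotone (trunc δ) :=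
  monotone_of_deriv_nonneg (fun t => (hasDerivAt_trunc δ t).differentiableAt) fun t => by
    rw [deriv_trunc]
    exact cut_nonneg δ t

theorem trunc_nonneg {δ : ℝ} (hδ : 0 < δ) (t : ℝ) : 0 ≤ trunc δ t := by
  rcases le_total t δ with h | h
  · rw [trunc_eq_zero hδ h]
  · rw [← trunc_eq_zero hδ (le_refl δ)]
    exact monotone_trunc δ h

theorem monotone_sub_trunc (δ : ℝ) : Monotone fun t => t - trunc δ t := by
  have h : ∀ t, HasDerivAt (fun t => t - trunc δ t) (1 - cut δ t) t := fun t =>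
    (hasDerivAt_id t).sub (hasDerivAt_trunc δ t)
  refine monotone_of_deriv_nonneg (fun t => (h t).differentiableAt) fun t => ?_
  rw [(h t).deriv]
  linarith [cut_le_one δ t]

theorem trunc_le {δ : ℝ} (hδ : 0 < δ) (t : ℝ) : trunc δ t ≤ max t 0 := by
  rcases le_total t 0 with h | h
  · rw [trunc_eq_zero hδ (by linarith)]
    exact le_max_right _ _
  · have := monotone_sub_trunc δ h
    simp only [trunc_eq_zero hδ hδ.le] at this
    exact (by linarith : trunc δ t ≤ t).trans (le_max_left _ _)

theorem le_trunc {δ : ℝ} (hδ : 0 < δ) (t : ℝ) : max t 0 - 2 * δ ≤ trunc δ t := by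
  rcases le_total t (2 * δ) with h | h
  · linarith [trunc_nonneg hδ t, max_le h (by linarith : 0 ≤ 2 * δ)]
  · have hc : Continuous (cut δ) := (contDiff_cut δ (n := 0)).continuous
    have h1 : trunc δ t = trunc δ (2 * δ) + ∫ s in (2 * δ)..t, cut δ s :=
      (intervalIntegral.integral_add_adjacent_intervals (hc.intervalIntegrable _ _)
        (hc.intervalIntegrable _ _)).symm
    have h2 : ∫ s in (2 * δ)..t, cut δ s = t - 2 * δ := by
      rw [intervalIntegral.integral_congr (g := fun _ => (1 : ℝ))]
      · simp
      · intro s hs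
        rw [uIcc_of_le h] at hs
        exact cut_eq_one hδ hs.1
    rw [h1, h2, max_eq_left (by linarith)]
    linarith [trunc_nonneg hδ (2 * δ)]

theorem lt_of_lt_trunc {δ t : ℝ} (hδ : 0 < δ) (ht : 2 * δ < trunc δ t) : 2 * δ < t := by
  by_contra! h
  have := (trunc_le hδ t).trans (max_le h (by linarith))
  linarith

/-! ### Chain rule for the gradient and the Laplacian -/

theorem fderiv_comp_real {g : ℝ → ℝ} {u : R2 → ℝ} {x : R2} (hg : DifferentiableAt ℝ g (u x))
    (hu : DifferentiableAt ℝ u x) : fderiv ℝ (g ∘ u) x = deriv g (u x) • fderiv ℝ u x :=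
  (hg.hasDerivAt.comp_hasFDerivAt x hu.hasFDerivAt).fderiv

theorem gradient_comp_real {g : ℝ → ℝ} {u : R2 → ℝ} {x : R2} (hg : DifferentiableAt ℝ g (u x))
    (hu : DifferentiableAt ℝ u x) : gradient (g ∘ u) x = deriv g (u x) • gradient u x := by
  rw [gradient, fderiv_comp_real hg hu, gradient, map_smulₛₗ]
  simp

theorem lap_comp_real {g : ℝ → ℝ} {u : R2 → ℝ} {x : R2} (hg : ContDiff ℝ 2 g)
    (hu : ContDiffAt ℝ 2 u x) :
    lap (g ∘ u) x = deriv g (u x) * lap u x + deriv (deriv g) (u x) * ‖gradient u x‖ ^ 2 := by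
  have hg1 : ContDiff ℝ 1 (deriv g) := by
    rw [show (2 : WithTop ℕ∞) = 1 + 1 by norm_num, contDiff_succ_iff_deriv] at hg
    exact hg.2.2
  have hud : ∀ᶠ y in 𝓝 x, DifferentiableAt ℝ u y := by
    filter_upwards [hu.eventually (by simp)] with y hy
    exact hy.differentiableAt two_ne_zero
  have hu1 : ContDiffAt ℝ 1 (fderiv ℝ u) x := hu.fderiv_right (by norm_num)
  rw [← real_inner_self_eq_norm_sq, inner_gradient_gradient]
  unfold lap
  rw [Finset.mul_sum, Finset.mul_sum, ← Finset.sum_add_distrib]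
  refine Finset.sum_congr rfl fun i _ => ?_
  set v : R2 := EuclideanSpace.single i 1
  have h1 : (fun y => fderiv ℝ (g ∘ u) y v) =ᶠ[𝓝 x]
      fun y => (deriv g ∘ u) y * fderiv ℝ u y v := by
    filter_upwards [hud] with y hy
    rw [fderiv_comp_real (hg.differentiable two_ne_zero _) hy]
    rfl
  have hd1 : DifferentiableAt ℝ (deriv g ∘ u) x :=
    (hg1.differentiable one_ne_zero _).comp x hud.self_of_nhds
  have hd2 : DifferentiableAt ℝ (fun y => fderiv ℝ u y v) x :=
    (hu1.differentiableAt one_ne_zero).clm_apply (differentiableAt_const v)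
  rw [h1.fderiv_eq, fderiv_fun_mul hd1 hd2,
    fderiv_comp_real (hg1.differentiable one_ne_zero _) hud.self_of_nhds]
  simp only [add_apply, smul_apply, smul_eq_mul,
    Function.comp_apply]
  ring

/-! ### Truncated solutions -/

theorem deriv_cut_nonneg {δ : ℝ} (hδ : 0 < δ) (t : ℝ) : 0 ≤ deriv (cut δ) t :=
  (monotone_cut hδ).deriv_nonneg

theorem deriv_cut_eq_zero {δ t : ℝ} (hδ : 0 < δ) (ht : 2 * δ ≤ t) : deriv (cut δ) t = 0 := by
  refine IsLocalMax.deriv_eq_zero (.of_forall fun s => ?_)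
  rw [cut_eq_one hδ ht]
  exact cut_le_one δ s

/-- The smooth truncation of `u` from below, extended by zero outside `Ω`. -/
def truncOn (Ω : Set R2) (δ : ℝ) (u : R2 → ℝ) : R2 → ℝ := Ω.indicator (trunc δ ∘ u)

section

variable {Ω : Set R2} {p δ : ℝ} {u : R2 → ℝ}

theorem IsSolution.neg (hu : IsSolution Ω p u) : IsSolution Ω p (fun x => -u x) := by
  obtain ⟨h1, h2, h3, h4⟩ := hu
  refine ⟨h1.neg, h2.neg, fun x hx => ?_, fun x hx => neg_eq_zero.2 (h4 x hx)⟩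
  have : lap (fun x => -u x) x = -lap u x := by
    unfold lap
    rw [← Finset.sum_neg_distrib]
    refine Finset.sum_congr rfl fun i _ => ?_
    have : (fun y => fderiv ℝ (fun x => -u x) y (EuclideanSpace.single i 1)) =
        fun y => -fderiv ℝ u y (EuclideanSpace.single i 1) := by
      ext y
      rw [fderiv_fun_neg]
      rfl
    rw [this, fderiv_fun_neg]
    rfl
  rw [this, h3 x hx, abs_neg]
  ring

theorem IsSolution.neg_lap_eq (hu : IsSolution Ω p u) {x : R2} (hx : x ∈ Ω) (h0 : 0 < u x) :
    -lap u x = max (u x) 0 ^ p := by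
  rw [hu.2.2.1 x hx, abs_of_pos h0, max_eq_left h0.le, rpow_sub_one h0.ne',
    div_mul_cancel₀ _ h0.ne']

theorem IsSolution.continuousOn (hu : IsSolution Ω p u) : ContinuousOn u (closure Ω) :=
  hu.2.1.continuousOn

theorem IsSolution.integrableOn_rpow (hbdd : Bornology.IsBounded Ω) (hu : IsSolution Ω p u) {q : ℝ}
    (hq : 0 ≤ q) : IntegrableOn (fun x => max (u x) 0 ^ q) Ω :=
  (((hu.continuousOn.sup continuousOn_const).rpow_const
    fun _ _ => Or.inr hq).integrableOn_compact hbdd.isCompact_closure).mono_set subset_closure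

theorem truncOn_of_mem {x : R2} (hx : x ∈ Ω) : truncOn Ω δ u x = trunc δ (u x) :=
  indicator_of_mem hx _

theorem truncOn_eventuallyEq (hop : IsOpen Ω) {x : R2} (hx : x ∈ Ω) :
    truncOn Ω δ u =ᶠ[𝓝 x] trunc δ ∘ u := by
  filter_upwards [hop.mem_nhds hx] with y hy using truncOn_of_mem hy

theorem tsupport_truncOn_subset (hop : IsOpen Ω) (hu : IsSolution Ω p u) (hδ : 0 < δ) :
    tsupport (truncOn Ω δ u) ⊆ {x ∈ Ω | δ ≤ u x} := by
  have hK : IsClosed {x ∈ closure Ω | δ ≤ u x} :=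
    isClosed_closure.isClosed_le continuousOn_const hu.continuousOn
  have h1 : tsupport (truncOn Ω δ u) ⊆ {x ∈ closure Ω | δ ≤ u x} := by
    refine closure_minimal (fun x hx => ?_) hK
    have hxΩ : x ∈ Ω := mem_of_indicator_ne_zero hx
    refine ⟨subset_closure hxΩ, ?_⟩
    by_contra! h
    exact hx (by rw [truncOn_of_mem hxΩ, trunc_eq_zero hδ h.le])
  intro x hx
  obtain ⟨h2, h3⟩ := h1 hx
  refine ⟨?_, h3⟩
  by_contra h4
  have := hu.2.2.2 x ⟨h2, by rwa [hop.interior_eq]⟩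
  linarith

theorem tsupport_truncOn_subset_self (hop : IsOpen Ω) (hu : IsSolution Ω p u) (hδ : 0 < δ) :
    tsupport (truncOn Ω δ u) ⊆ Ω := fun _ hx => (tsupport_truncOn_subset hop hu hδ hx).1

theorem hasCompactSupport_truncOn (hop : IsOpen Ω) (hbdd : Bornology.IsBounded Ω)
    (hu : IsSolution Ω p u) (hδ : 0 < δ) : HasCompactSupport (truncOn Ω δ u) :=
  hbdd.isCompact_closure.of_isClosed_subset (isClosed_tsupport _)
    ((tsupport_truncOn_subset_self hop hu hδ).trans subset_closure)

theorem contDiff_truncOn (hop : IsOpen Ω) (hu : IsSolution Ω p u) (hδ : 0 < δ) :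
    ContDiff ℝ 2 (truncOn Ω δ u) := by
  rw [contDiff_iff_contDiffAt]
  intro x
  by_cases hx : x ∈ tsupport (truncOn Ω δ u)
  · have hxΩ := tsupport_truncOn_subset_self hop hu hδ hx
    exact ((contDiff_trunc δ).contDiffAt.comp x
      (hu.1.contDiffAt (hop.mem_nhds hxΩ))).congr_of_eventuallyEq (truncOn_eventuallyEq hop hxΩ)
  · exact contDiffAt_const.congr_of_eventuallyEq (notMem_tsupport_iff_eventuallyEq.1 hx)

theorem gradient_truncOn (hop : IsOpen Ω) (hu : IsSolution Ω p u) {x : R2} (hx : x ∈ Ω) :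
    gradient (truncOn Ω δ u) x = cut δ (u x) • gradient u x := by
  rw [(truncOn_eventuallyEq hop hx).gradient_eq, gradient_comp_real
    (hasDerivAt_trunc δ _).differentiableAt
    ((hu.1.contDiffAt (hop.mem_nhds hx)).differentiableAt two_ne_zero), deriv_trunc]

theorem lap_truncOn (hop : IsOpen Ω) (hu : IsSolution Ω p u) {x : R2} (hx : x ∈ Ω) :
    lap (truncOn Ω δ u) x =
      cut δ (u x) * lap u x + deriv (cut δ) (u x) * ‖gradient u x‖ ^ 2 := by
  rw [lap_congr (truncOn_eventuallyEq hop hx), lap_comp_real (contDiff_trunc δ)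
    (hu.1.contDiffAt (hop.mem_nhds hx)), deriv_trunc]

theorem neg_lap_truncOn_le (hop : IsOpen Ω) (hu : IsSolution Ω p u) (hδ : 0 < δ) {x : R2}
    (hx : x ∈ Ω) : -lap (truncOn Ω δ u) x ≤ max (u x) 0 ^ p := by
  have h1 := mul_nonneg (deriv_cut_nonneg hδ (u x)) (sq_nonneg ‖gradient u x‖)
  have h2 : 0 ≤ max (u x) 0 ^ p := by positivity
  rw [lap_truncOn hop hu hx]
  rcases le_or_gt (u x) 0 with h0 | h0
  · rw [cut_eq_zero hδ (by linarith)]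
    linarith
  · have h3 := mul_le_mul_of_nonneg_right (cut_le_one δ (u x)) h2
    have h4 : lap u x = -max (u x) 0 ^ p := by rw [← hu.neg_lap_eq hx h0, neg_neg]
    rw [h4]
    linarith

theorem neg_lap_truncOn_eq (hop : IsOpen Ω) (hu : IsSolution Ω p u) (hδ : 0 < δ) {x : R2}
    (hx : x ∈ Ω) (h : 2 * δ ≤ u x) : -lap (truncOn Ω δ u) x = max (u x) 0 ^ p := by
  rw [lap_truncOn hop hu hx, cut_eq_one hδ h, deriv_cut_eq_zero hδ h,
    ← hu.neg_lap_eq hx (by linarith)]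
  ring

theorem truncOn_nonneg (hδ : 0 < δ) (x : R2) : 0 ≤ truncOn Ω δ u x :=
  indicator_nonneg (fun _ _ => trunc_nonneg hδ _) x

theorem truncOn_le (hδ : 0 < δ) {x : R2} (hx : x ∈ Ω) : truncOn Ω δ u x ≤ max (u x) 0 := by
  rw [truncOn_of_mem hx]
  exact trunc_le hδ _

theorem integral_norm_gradient_truncOn_sq_le (hop : IsOpen Ω) (hbdd : Bornology.IsBounded Ω)
    (hp : 1 < p) (hu : IsSolution Ω p u) (hδ : 0 < δ) :
    ∫ x, ‖gradient (truncOn Ω δ u) x‖ ^ 2 ≤ ∫ x in Ω, max (u x) 0 ^ (p + 1) := by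
  have hC := contDiff_truncOn hop hu hδ
  have hc := hasCompactSupport_truncOn hop hbdd hu hδ
  have hs := tsupport_truncOn_subset_self hop hu hδ
  have h1 := integral_inner_gradient (hC.of_le (by norm_num)) hc hC
  simp_rw [real_inner_self_eq_norm_sq] at h1
  rw [h1, ← integral_neg, integral_eq_setIntegral_of_tsupport_subset hs fun x hx => by
    rw [lap_eq_zero_of_notMem_tsupport hx, mul_zero, neg_zero]]
  refine setIntegral_mono_on ?_ (hu.integrableOn_rpow hbdd (by linarith)) hop.measurableSet
    fun x hx => ?_
  · exact ((hC.continuous.mul (continuous_lap hC)).neg.integrable_of_hasCompactSupport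
      hc.mul_right.neg).integrableOn
  · have hw : 0 ≤ max (u x) 0 := le_max_right _ _
    calc -(truncOn Ω δ u x * lap (truncOn Ω δ u) x)
        = truncOn Ω δ u x * -lap (truncOn Ω δ u) x := by ring
      _ ≤ truncOn Ω δ u x * max (u x) 0 ^ p :=
        mul_le_mul_of_nonneg_left (neg_lap_truncOn_le hop hu hδ hx) (truncOn_nonneg hδ x)
      _ ≤ max (u x) 0 * max (u x) 0 ^ p :=
        mul_le_mul_of_nonneg_right (truncOn_le hδ hx) (by positivity)
      _ = max (u x) 0 ^ (p + 1) := by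
        rw [rpow_add_one' hw (by linarith), mul_comm]

theorem setIntegral_rpow_le_setIntegral_norm_gradient_sq (hop : IsOpen Ω)
    (hbdd : Bornology.IsBounded Ω) (hp : 1 < p) (hu : IsSolution Ω p u)
    (hg : IntegrableOn (fun x => ‖gradient u x‖ ^ 2) Ω) :
    ∫ x in Ω, max (u x) 0 ^ (p + 1) ≤ ∫ x in Ω ∩ u ⁻¹' Ioi 0, ‖gradient u x‖ ^ 2 := by
  have hpos : IsOpen (Ω ∩ u ⁻¹' Ioi 0) := hu.1.continuousOn.isOpen_inter_preimage hop isOpen_Ioi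
  have hIp := hu.integrableOn_rpow hbdd (q := p) (by linarith)
  have key : ∀ δ > 0, ∫ x in Ω, max (u x) 0 ^ (p + 1) ≤
      (∫ x in Ω ∩ u ⁻¹' Ioi 0, ‖gradient u x‖ ^ 2) + δ * (2 * ∫ x in Ω, max (u x) 0 ^ p) := by
    intro δ hδ
    have hδ2 : 0 < δ / 2 := by positivity
    set F := truncOn Ω δ u with hF
    set k := truncOn Ω (δ / 2) u with hk
    have hCF : ContDiff ℝ 2 F := contDiff_truncOn hop hu hδ
    have hCk : ContDiff ℝ 2 k := contDiff_truncOn hop hu hδ2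
    have hF1 : ContDiff ℝ 1 F := hCF.of_le (by norm_num)
    have hk1 : ContDiff ℝ 1 k := hCk.of_le (by norm_num)
    have hcF : HasCompactSupport F := hasCompactSupport_truncOn hop hbdd hu hδ
    have hs : tsupport F ⊆ Ω := tsupport_truncOn_subset_self hop hu hδ
    have h1 := integral_inner_gradient hF1 hcF hCk
    have h2 : -∫ x, F x * lap k x = ∫ x in Ω, F x * max (u x) 0 ^ p := by
      rw [← integral_neg, integral_eq_setIntegral_of_tsupport_subset hs fun x hx => by
        rw [image_eq_zero_of_notMem_tsupport hx, zero_mul, neg_zero]]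
      refine setIntegral_congr_fun hop.measurableSet fun x hx => ?_
      by_cases hxs : x ∈ tsupport F
      · have h3 := (tsupport_truncOn_subset hop hu hδ hxs).2
        rw [← neg_lap_truncOn_eq hop hu hδ2 hx (by linarith), ← mul_neg]
      · rw [image_eq_zero_of_notMem_tsupport hxs]
        ring
    have h3 : ∫ x, inner ℝ (gradient F x) (gradient k x) ≤
        ∫ x in Ω ∩ u ⁻¹' Ioi 0, ‖gradient u x‖ ^ 2 := by
      have hs' : tsupport F ⊆ Ω ∩ u ⁻¹' Ioi 0 := fun x hx =>
        ⟨hs hx, hδ.trans_le (tsupport_truncOn_subset hop hu hδ hx).2⟩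
      rw [integral_eq_setIntegral_of_tsupport_subset hs' fun x hx => by
        rw [gradient_eq_zero_of_notMem_tsupport hx, inner_zero_left]]
      refine setIntegral_mono_on (integrable_inner_gradient hF1 hcF hk1).integrableOn
        (hg.mono_set inter_subset_left) hpos.measurableSet fun x hx => ?_
      rw [hF, hk, gradient_truncOn hop hu hx.1, gradient_truncOn hop hu hx.1, inner_smul_left,
        inner_smul_right, real_inner_self_eq_norm_sq, ← mul_assoc]
      exact mul_le_of_le_one_left (sq_nonneg _)
        (mul_le_one₀ (cut_le_one _ _) (cut_nonneg _ _) (cut_le_one _ _))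
    have h4 : ∫ x in Ω, (max (u x) 0 ^ (p + 1) - 2 * δ * max (u x) 0 ^ p) ≤
        ∫ x in Ω, F x * max (u x) 0 ^ p := by
      refine setIntegral_mono_on ((hu.integrableOn_rpow hbdd (by linarith)).sub
        (hIp.const_mul _)) ?_ hop.measurableSet fun x hx => ?_
      · refine (hIp.bdd_mul (c := ?_) hCF.continuous.aestronglyMeasurable ?_)
        · exact (hCF.continuous.bounded_above_of_compact_support hcF).choose
        · exact .of_forall (hCF.continuous.bounded_above_of_compact_support hcF).choose_spec
      · have hw : 0 ≤ max (u x) 0 := le_max_right _ _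
        have h5 : max (u x) 0 - 2 * δ ≤ F x := by
          rw [hF, truncOn_of_mem hx]
          exact le_trunc hδ _
        rw [rpow_add_one' hw (by linarith)]
        have := mul_le_mul_of_nonneg_right h5 (rpow_nonneg hw p)
        linarith
    rw [integral_sub (hu.integrableOn_rpow hbdd (by linarith)) (hIp.const_mul _),
      integral_const_mul] at h4
    linarith
  have hV : 0 ≤ ∫ x in Ω, max (u x) 0 ^ p := integral_nonneg fun x => by positivity
  refine le_of_forall_pos_le_add fun ε hε => ?_
  refine (key (ε / (2 * (∫ x in Ω, max (u x) 0 ^ p) + 1)) (by positivity)).trans ?_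
  gcongr
  rw [div_mul_eq_mul_div, div_le_iff₀ (by positivity)]
  nlinarith

theorem setIntegral_rpow_add_le (hop : IsOpen Ω) (hbdd : Bornology.IsBounded Ω) (hp : 1 < p)
    (hu : IsSolution Ω p u) (hg : IntegrableOn (fun x => ‖gradient u x‖ ^ 2) Ω) :
    (∫ x in Ω, max (u x) 0 ^ (p + 1)) + ∫ x in Ω, max (-u x) 0 ^ (p + 1) ≤
      ∫ x in Ω, ‖gradient u x‖ ^ 2 := by
  have hn : ∀ x, gradient (fun x => -u x) x = -gradient u x := fun x => by
    rw [gradient, fderiv_fun_neg, map_neg, gradient]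
  have h1 := setIntegral_rpow_le_setIntegral_norm_gradient_sq hop hbdd hp hu hg
  have h2 := setIntegral_rpow_le_setIntegral_norm_gradient_sq hop hbdd hp hu.neg
    (by simpa only [hn, norm_neg] using hg)
  simp only [hn, norm_neg] at h2
  have hm : MeasurableSet (Ω ∩ (fun x => -u x) ⁻¹' Ioi 0) :=
    (hu.neg.1.continuousOn.isOpen_inter_preimage hop isOpen_Ioi).measurableSet
  have hd : Disjoint (Ω ∩ u ⁻¹' Ioi 0) (Ω ∩ (fun x => -u x) ⁻¹' Ioi 0) := by
    refine disjoint_left.2 fun x hx hx' => ?_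
    have h3 : 0 < u x := hx.2
    have h4 : 0 < -u x := hx'.2
    linarith
  refine (add_le_add h1 h2).trans ?_
  rw [← setIntegral_union hd hm (hg.mono_set inter_subset_left) (hg.mono_set inter_subset_left)]
  exact setIntegral_mono_set hg (.of_forall fun x => sq_nonneg _)
    (LE.le.eventuallyLE (union_subset inter_subset_left inter_subset_left))

end

/-! ### Quantitative estimates at a fixed exponent -/

section

variable {Ω : Set R2} {p δ D : ℝ} {u : R2 → ℝ}

theorem setIntegral_rpow_pos (hop : IsOpen Ω) (hbdd : Bornology.IsBounded Ω) (hp : 1 < p)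
    (hu : IsSolution Ω p u) (hpos : ∃ x ∈ Ω, 0 < u x) :
    0 < ∫ x in Ω, max (u x) 0 ^ (p + 1) := by
  obtain ⟨x, hx, hx0⟩ := hpos
  rw [setIntegral_pos_iff_support_of_nonneg_ae (.of_forall fun x => by positivity)
    (hu.integrableOn_rpow hbdd (by linarith))]
  refine ((hu.1.continuousOn.isOpen_inter_preimage hop isOpen_Ioi).measure_pos volume
    ⟨x, hx, hx0⟩).trans_le (measure_mono fun y hy => ⟨?_, hy.1⟩)
  have : 0 < u y := hy.2
  exact (rpow_pos_of_pos (lt_max_of_lt_left this) _).ne'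

theorem setIntegral_rpow_le_moserConst (hop : IsOpen Ω) (hbdd : Bornology.IsBounded Ω)
    (hp : 1 < p) (hu : IsSolution Ω p u) (hpos : ∃ x ∈ Ω, 0 < u x) (hD : 0 < D)
    (hSD : ∀ x ∈ Ω, Ω ⊆ ball x D) {b η : ℝ} (hb : 0 < b) (hb1 : b < 1) (hη : 0 < η) :
    ∫ x in Ω, max (u x) 0 ^ (p + 1) ≤ moserConst Ω D b η *
      ((p + 1) * (∫ x in Ω, max (u x) 0 ^ (p + 1)) /
        (2 * exp 1 * (4 * π * b / (1 + η)))) ^ ((p + 1) / 2) := by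
  have hW := setIntegral_rpow_pos hop hbdd hp hu hpos
  have hlim : Tendsto (fun δ : ℝ => ∫ x in Ω, |truncOn Ω δ u x| ^ (p + 1)) (𝓝[>] 0)
      (𝓝 (∫ x in Ω, max (u x) 0 ^ (p + 1))) := by
    refine tendsto_integral_filter_of_dominated_convergence (fun x => max (u x) 0 ^ (p + 1))
      ?_ ?_ (hu.integrableOn_rpow hbdd (by linarith)) ?_
    · filter_upwards [self_mem_nhdsWithin] with δ hδ
      exact ((contDiff_truncOn hop hu hδ).continuous.abs.rpow_const
        fun _ => Or.inr (by linarith)).aestronglyMeasurable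
    · filter_upwards [self_mem_nhdsWithin] with δ hδ
      refine (ae_restrict_iff' hop.measurableSet).2 (.of_forall fun x hx => ?_)
      rw [Real.norm_of_nonneg (by positivity), abs_of_nonneg (truncOn_nonneg hδ x)]
      exact rpow_le_rpow (truncOn_nonneg hδ x) (truncOn_le hδ hx) (by linarith)
    · refine (ae_restrict_iff' hop.measurableSet).2 (.of_forall fun x hx => ?_)
      refine Tendsto.rpow_const ?_ (Or.inr (by linarith))
      rw [← abs_of_nonneg (le_max_right (u x) 0)]
      refine Tendsto.abs ?_
      have h1 : Tendsto (fun δ : ℝ => max (u x) 0 - 2 * δ) (𝓝[>] 0) (𝓝 (max (u x) 0)) := by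
        have : Continuous fun δ : ℝ => max (u x) 0 - 2 * δ := by fun_prop
        simpa using this.tendsto' 0 _ (by simp) |>.mono_left nhdsWithin_le_nhds
      refine tendsto_of_tendsto_of_tendsto_of_le_of_le' h1 tendsto_const_nhds ?_ ?_
      · filter_upwards [self_mem_nhdsWithin] with δ hδ
        rw [truncOn_of_mem hx]
        exact le_trunc hδ _
      · filter_upwards [self_mem_nhdsWithin] with δ hδ using truncOn_le hδ hx
  refine le_of_tendsto hlim ?_
  filter_upwards [self_mem_nhdsWithin] with δ hδ
  exact setIntegral_abs_rpow_le ((contDiff_truncOn hop hu hδ).of_le (by norm_num))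
    (hasCompactSupport_truncOn hop hbdd hu hδ) hop.measurableSet hbdd.measure_lt_top.ne hD.le
    hb hb1 hη (by linarith) hSD (tsupport_truncOn_subset_self hop hu hδ) hW
    (integral_norm_gradient_truncOn_sq_le hop hbdd hp hu hδ)

/-- The gradient pairing of the truncated solution with the logarithmic potential. -/
def potPair (Ω : Set R2) (δ s : ℝ) (u : R2 → ℝ) (x₀ : R2) : ℝ :=
  ∫ y, inner ℝ (gradient (truncOn Ω δ u) y) (gradient (logPot s x₀) y)

theorem le_potPair (hop : IsOpen Ω) (hbdd : Bornology.IsBounded Ω)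
    (hu : IsSolution Ω p u) (hδ : 0 < δ) (hD : 0 < D) (hSD : ∀ x ∈ Ω, Ω ⊆ ball x D)
    {x₀ : R2} (hx₀ : x₀ ∈ Ω) {A s : ℝ} (hs : 0 < s) (hA : ∀ x ∈ Ω, max (u x) 0 ^ p ≤ A) :
    max (u x₀) 0 - 2 * δ ≤
      potPair Ω δ s u x₀ + A * (s / 4 * (1 + log (1 + D ^ 2 / s))) := by
  have hA0 : 0 ≤ A := le_trans (by positivity) (hA x₀ hx₀)
  have h1 : max (u x₀) 0 - 2 * δ ≤ truncOn Ω δ u x₀ := by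
    rw [truncOn_of_mem hx₀]
    exact le_trunc hδ _
  have hsub := tsupport_truncOn_subset_self hop hu hδ
  refine h1.trans (le_integral_inner_gradient_logPot (contDiff_truncOn hop hu hδ)
    (hasCompactSupport_truncOn hop hbdd hu hδ) hD hA0 hs
    (hsub.trans (hSD x₀ hx₀)) fun x => ?_)
  by_cases hx : x ∈ tsupport (truncOn Ω δ u)
  · exact (neg_lap_truncOn_le hop hu hδ (hsub hx)).trans (hA x (hsub hx))
  · rw [lap_eq_zero_of_notMem_tsupport hx, neg_zero]
    exact hA0

theorem setIntegral_inner_le {f g : R2 → R2} (hf : Continuous f) (hg : Continuous g) (x₀ : R2)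
    (D : ℝ) : (∫ y in ball x₀ D, inner ℝ (f y) (g y)) ^ 2 ≤
      (∫ y in ball x₀ D, ‖f y‖ ^ 2) * ∫ y in ball x₀ D, ‖g y‖ ^ 2 := by
  have h1 : |∫ y in ball x₀ D, inner ℝ (f y) (g y)| ≤ ∫ y in ball x₀ D, ‖f y‖ * ‖g y‖ :=
    abs_integral_le_integral_abs.trans
      (setIntegral_mono (integrableOn_ball_of_continuous (hf.inner hg).abs _ _)
        (integrableOn_ball_of_continuous (hf.norm.mul hg.norm) _ _)
        fun y => abs_real_inner_le_norm _ _)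
  rw [← sq_abs]
  refine (pow_le_pow_left₀ (abs_nonneg _) h1 2).trans ?_
  exact sq_integral_mul_le (integrableOn_ball_of_continuous (hf.norm.pow 2) _ _)
    (integrableOn_ball_of_continuous (hg.norm.pow 2) _ _)
    (integrableOn_ball_of_continuous (hf.norm.mul hg.norm) _ _)

theorem setIntegral_norm_gradient_truncOn_sq_le (hop : IsOpen Ω) (hbdd : Bornology.IsBounded Ω)
    (hp : 1 < p) (hu : IsSolution Ω p u) (hδ : 0 < δ) (S : Set R2) :
    ∫ x in S, ‖gradient (truncOn Ω δ u) x‖ ^ 2 ≤ ∫ x in Ω, max (u x) 0 ^ (p + 1) :=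
  (setIntegral_le_integral (integrable_norm_gradient_sq
    ((contDiff_truncOn hop hu hδ).of_le (by norm_num)) (hasCompactSupport_truncOn hop hbdd hu hδ))
    (.of_forall fun _ => sq_nonneg _)).trans
    (integral_norm_gradient_truncOn_sq_le hop hbdd hp hu hδ)

theorem potPair_eq (hop : IsOpen Ω) (hu : IsSolution Ω p u) (hδ : 0 < δ)
    (hSD : ∀ x ∈ Ω, Ω ⊆ ball x D) {x₀ : R2} (hx₀ : x₀ ∈ Ω) {s : ℝ} :
    potPair Ω δ s u x₀ = ∫ y in ball x₀ D,
      inner ℝ (gradient (truncOn Ω δ u) y) (gradient (logPot s x₀) y) :=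
  integral_eq_setIntegral_of_tsupport_subset
    ((tsupport_truncOn_subset_self hop hu hδ).trans (hSD x₀ hx₀)) fun y hy => by
      rw [gradient_eq_zero_of_notMem_tsupport hy, inner_zero_left]

theorem potPair_sq_le (hop : IsOpen Ω) (hbdd : Bornology.IsBounded Ω)
    (hp : 1 < p) (hu : IsSolution Ω p u) (hδ : 0 < δ) (hD : 0 < D) (hSD : ∀ x ∈ Ω, Ω ⊆ ball x D)
    {x₀ : R2} (hx₀ : x₀ ∈ Ω) {s : ℝ} (hs : 0 < s) :
    potPair Ω δ s u x₀ ^ 2 ≤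
      (∫ x in Ω, max (u x) 0 ^ (p + 1)) * (1 / (4 * π) * log (1 + D ^ 2 / s)) := by
  have hG1 : ContDiff ℝ 1 (logPot s x₀) := contDiff_logPot hs x₀ (n := 1)
  have hF1 : ContDiff ℝ 1 (truncOn Ω δ u) := (contDiff_truncOn hop hu hδ).of_le (by norm_num)
  rw [potPair_eq hop hu hδ hSD hx₀]
  refine (setIntegral_inner_le (continuous_gradient hF1) (continuous_gradient hG1) x₀ D).trans ?_
  exact mul_le_mul (setIntegral_norm_gradient_truncOn_sq_le hop hbdd hp hu hδ _)
    (setIntegral_ball_norm_gradient_logPot_sq_le hs x₀ hD.le)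
    (integral_nonneg fun _ => sq_nonneg _) (integral_nonneg fun _ => by positivity)

theorem exists_abs_deriv_cut_le (hδ : 0 < δ) : ∃ C, 0 ≤ C ∧ ∀ t, |deriv (cut δ) t| ≤ C := by
  have hc : Continuous (deriv (cut δ)) :=
    (contDiff_cut δ (n := 1)).continuous_deriv le_rfl
  obtain ⟨C, hC⟩ := (isCompact_Icc (a := δ) (b := 2 * δ)).exists_bound_of_continuousOn
    hc.continuousOn
  refine ⟨max C 0, le_max_right _ _, fun t => ?_⟩
  rcases le_or_gt t δ with h | h
  · have : deriv (cut δ) t = 0 := IsLocalMin.deriv_eq_zero (.of_forall fun s => by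
      rw [cut_eq_zero hδ h]
      exact cut_nonneg δ s)
    simp [this]
  rcases le_or_gt (2 * δ) t with h' | h'
  · simp [deriv_cut_eq_zero hδ h']
  · exact (hC t ⟨h.le, h'.le⟩).trans (le_max_left _ _)

theorem setIntegral_rpow_le_potPair (hop : IsOpen Ω) (hbdd : Bornology.IsBounded Ω)
    (hp : 1 < p) (hu : IsSolution Ω p u) (hδ : 0 < δ) (hδ8 : δ ≤ 1 / 8) (hD : 0 < D)
    (hSD : ∀ x ∈ Ω, Ω ⊆ ball x D) {x₀ : R2} (hx₀ : x₀ ∈ Ω) {s C N : ℝ} (hs : 0 < s)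
    (hC : ∀ t, |deriv (cut (1 / 4)) t| ≤ C) (hN : N = 1 / (4 * π) * log (1 + D ^ 2 / s))
    (hP : 0 ≤ potPair Ω δ s u x₀) :
    ∫ x in Ω, max (u x) 0 ^ p ≤ potPair Ω δ s u x₀ / N +
      C * √(((∫ x in Ω, max (u x) 0 ^ (p + 1)) - potPair Ω δ s u x₀ ^ 2 / N) *
        ∫ x in Ω, max (u x) 0 ^ (p + 1)) + (3 / 4) ^ p * volume.real Ω := by
  have hπ := pi_pos
  have hNpos : 0 < N := by
    rw [hN]
    have : 0 < D ^ 2 / s := by positivity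
    exact mul_pos (by positivity) (log_pos (by linarith))
  have hC0 : 0 ≤ C := (abs_nonneg _).trans (hC 0)
  set W := ∫ x in Ω, max (u x) 0 ^ (p + 1) with hW
  set f := truncOn Ω δ u with hf
  set G := logPot s x₀ with hG
  set P := potPair Ω δ s u x₀ with hPdef
  set h : R2 → ℝ := cut (1 / 4) ∘ f with hh
  have hCf : ContDiff ℝ 2 f := contDiff_truncOn hop hu hδ
  have hf1 : ContDiff ℝ 1 f := hCf.of_le (by norm_num)
  have hG1 : ContDiff ℝ 1 G := contDiff_logPot hs x₀ (n := 1)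
  have hh1 : ContDiff ℝ 1 h := (contDiff_cut _ (n := 1)).comp hf1
  have hfc : HasCompactSupport f := hasCompactSupport_truncOn hop hbdd hu hδ
  have h14 : (0 : ℝ) < 1 / 4 := by norm_num
  have hhc : HasCompactSupport h := hfc.comp_left (cut_eq_zero h14 h14.le)
  have hhf : tsupport h ⊆ tsupport f :=
    closure_mono (Function.support_comp_subset (cut_eq_zero h14 h14.le) f)
  have hfΩ : tsupport f ⊆ Ω := tsupport_truncOn_subset_self hop hu hδ
  have hhB : tsupport h ⊆ ball x₀ D := (hhf.trans hfΩ).trans (hSD x₀ hx₀)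
  have hgf := continuous_gradient hf1
  have hgG := continuous_gradient hG1
  have hgh := continuous_gradient hh1
  have hIp := hu.integrableOn_rpow hbdd (q := p) (by linarith)
  have hh01 : ∀ y, |h y| ≤ 1 := fun y =>
    (abs_of_nonneg (cut_nonneg _ _)).trans_le (cut_le_one _ _)
  have e1 : ∫ x in Ω, h x * max (u x) 0 ^ p = ∫ x, inner ℝ (gradient h x) (gradient f x) := by
    rw [integral_inner_gradient hh1 hhc hCf, ← integral_neg,
      integral_eq_setIntegral_of_tsupport_subset (hhf.trans hfΩ) fun x hx => by
        rw [image_eq_zero_of_notMem_tsupport hx, zero_mul, neg_zero]]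
    refine setIntegral_congr_fun hop.measurableSet fun x hx => ?_
    rcases le_or_gt (f x) (1 / 4) with hx4 | hx4
    · have : h x = 0 := cut_eq_zero h14 hx4
      simp only [this, zero_mul, neg_zero]
    · rw [hf, truncOn_of_mem hx] at hx4
      have := lt_of_lt_trunc hδ (by linarith : 2 * δ < trunc δ (u x))
      rw [← neg_lap_truncOn_eq hop hu hδ hx this.le, mul_neg]
  have e2 : ∫ x, inner ℝ (gradient h x) (gradient f x) =
      P / N * (∫ x, h x * logKer s x₀ x) +
      ∫ x in ball x₀ D, inner ℝ (gradient h x) (gradient f x - (P / N) • gradient G x) := by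
    have hz : ∀ g : R2 → R2, ∀ x ∉ tsupport h, inner ℝ (gradient h x) (g x) = 0 :=
      fun g x hx => by rw [gradient_eq_zero_of_notMem_tsupport hx, inner_zero_left]
    rw [integral_mul_logKer hh1 hhc hs,
      ← integral_eq_setIntegral_of_tsupport_subset hhB
        (hz fun x => gradient f x - (P / N) • gradient G x)]
    simp_rw [inner_sub_right, inner_smul_right]
    rw [integral_sub (integrable_inner_gradient hh1 hhc hf1)
      ((integrable_inner_gradient hh1 hhc hG1).const_mul _), integral_const_mul]
    ring
  have e3 : ∫ x, h x * logKer s x₀ x ≤ 1 :=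
    (le_abs_self _).trans (abs_integral_mul_logKer_le hs hh01 x₀)
  have e4 : ∫ x in ball x₀ D, ‖gradient f x - (P / N) • gradient G x‖ ^ 2 ≤ W - P ^ 2 / N := by
    have hI1 : IntegrableOn (fun x => ‖gradient f x‖ ^ 2) (ball x₀ D) :=
      integrableOn_ball_of_continuous (hgf.norm.pow 2) x₀ D
    have hI2 := (integrableOn_ball_of_continuous (hgf.inner hgG) x₀ D).const_mul (2 * (P / N))
    have hI3 : IntegrableOn (fun x => (P / N) ^ 2 * ‖gradient G x‖ ^ 2) (ball x₀ D) :=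
      (integrableOn_ball_of_continuous (hgG.norm.pow 2) x₀ D).const_mul ((P / N) ^ 2)
    have e : ∀ x, ‖gradient f x - (P / N) • gradient G x‖ ^ 2 = ‖gradient f x‖ ^ 2 -
        2 * (P / N) * inner ℝ (gradient f x) (gradient G x) +
        (P / N) ^ 2 * ‖gradient G x‖ ^ 2 := fun x => by
      rw [norm_sub_sq_real, inner_smul_right, norm_smul, mul_pow, Real.norm_eq_abs, sq_abs]
      ring
    simp_rw [e]
    have hI12 : IntegrableOn (fun x => ‖gradient f x‖ ^ 2 -
        2 * (P / N) * inner ℝ (gradient f x) (gradient G x)) (ball x₀ D) := hI1.sub hI2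
    rw [integral_add hI12 hI3, integral_sub hI1 hI2, integral_const_mul, integral_const_mul,
      ← potPair_eq hop hu hδ hSD hx₀, ← hPdef]
    have h1 := setIntegral_norm_gradient_truncOn_sq_le hop hbdd hp hu hδ (ball x₀ D)
    have h2 := mul_le_mul_of_nonneg_left (setIntegral_ball_norm_gradient_logPot_sq_le hs x₀ hD.le)
      (sq_nonneg (P / N))
    rw [← hN] at h2
    have h3 : (P / N) ^ 2 * N = P ^ 2 / N := by field_simp
    have h4 : 2 * (P / N) * P = 2 * (P ^ 2 / N) := by ring
    linarith
  have e5 : ∫ x in ball x₀ D, ‖gradient h x‖ ^ 2 ≤ C ^ 2 * W := by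
    calc ∫ x in ball x₀ D, ‖gradient h x‖ ^ 2
        ≤ ∫ x in ball x₀ D, C ^ 2 * ‖gradient f x‖ ^ 2 := by
          refine setIntegral_mono (integrableOn_ball_of_continuous (hgh.norm.pow 2) _ _)
            ((integrableOn_ball_of_continuous (hgf.norm.pow 2) _ _).const_mul _) fun x => ?_
          rw [gradient_comp_real ((contDiff_cut _ (n := 1)).differentiable one_ne_zero _)
            (hf1.differentiable one_ne_zero x), norm_smul, mul_pow, Real.norm_eq_abs]
          exact mul_le_mul_of_nonneg_right (pow_le_pow_left₀ (abs_nonneg _) (hC _) 2)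
            (sq_nonneg _)
      _ ≤ C ^ 2 * W := by
          rw [integral_const_mul]
          exact mul_le_mul_of_nonneg_left
            (setIntegral_norm_gradient_truncOn_sq_le hop hbdd hp hu hδ _) (sq_nonneg _)
  have e6 : ∫ x in ball x₀ D, inner ℝ (gradient h x) (gradient f x - (P / N) • gradient G x) ≤
      C * √((W - P ^ 2 / N) * W) := by
    have h1 := setIntegral_inner_le hgh (hgf.sub (hgG.const_smul (P / N))) x₀ D
    have h2 := h1.trans (mul_le_mul e5 e4 (integral_nonneg fun _ => sq_nonneg _)
      (mul_nonneg (sq_nonneg _) (integral_nonneg fun _ => by positivity)))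
    have h3 := abs_le_sqrt h2
    rw [mul_assoc, sqrt_mul (sq_nonneg C), sqrt_sq hC0, mul_comm W] at h3
    exact (le_abs_self _).trans h3
  have e7 : ∫ x in Ω, (1 - h x) * max (u x) 0 ^ p ≤ (3 / 4) ^ p * volume.real Ω := by
    have h1 : ‖∫ x in Ω, (1 - h x) * max (u x) 0 ^ p‖ ≤ (3 / 4) ^ p * volume.real Ω := by
      refine norm_setIntegral_le_of_norm_le_const hbdd.measure_lt_top fun x hx => ?_
      have hw : 0 ≤ max (u x) 0 := le_max_right _ _
      have h0 : h x ≤ 1 := cut_le_one _ _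
      have h0' : 0 ≤ h x := cut_nonneg _ _
      rw [Real.norm_of_nonneg (mul_nonneg (by linarith) (rpow_nonneg hw _))]
      rcases le_or_gt (1 / 2) (f x) with hx2 | hx2
      · have : h x = 1 := cut_eq_one h14 (by linarith)
        rw [this, sub_self, zero_mul]
        positivity
      · rw [hf, truncOn_of_mem hx] at hx2
        have h5 := le_trunc hδ (u x)
        calc (1 - h x) * max (u x) 0 ^ p ≤ 1 * max (u x) 0 ^ p :=
              mul_le_mul_of_nonneg_right (by linarith) (rpow_nonneg hw _)
          _ ≤ (3 / 4) ^ p := by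
              rw [one_mul]
              exact rpow_le_rpow hw (by linarith) (by linarith)
    exact (le_abs_self _).trans h1
  have e8 : ∫ x in Ω, max (u x) 0 ^ p =
      (∫ x in Ω, h x * max (u x) 0 ^ p) + ∫ x in Ω, (1 - h x) * max (u x) 0 ^ p := by
    have hI := hIp.bdd_mul hh1.continuous.aestronglyMeasurable (.of_forall hh01)
    have e : ∀ x, (1 - h x) * max (u x) 0 ^ p =
        max (u x) 0 ^ p - h x * max (u x) 0 ^ p := fun x => by ring
    simp_rw [e]
    rw [integral_sub hIp hI]
    ring
  have e9 : P / N * (∫ x, h x * logKer s x₀ x) ≤ P / N :=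
    mul_le_of_le_one_right (div_nonneg hP hNpos.le) e3
  rw [e8, e1, e2]
  linarith

end

/-! ### Asymptotics as the exponent tends to infinity -/

theorem exists_forall_subset_ball {Ω : Set R2} (hbdd : Bornology.IsBounded Ω) :
    ∃ D > 0, ∀ x ∈ Ω, Ω ⊆ ball x D :=
  ⟨diam Ω + 1, by positivity, fun _ hx _ hy =>
    (dist_le_diam_of_mem hbdd hy hx).trans_lt (lt_add_one _)⟩

theorem tendsto_add_one_mul_rpow {ρ : ℝ} (h0 : 0 < ρ) (h1 : ρ < 1) :
    Tendsto (fun p : ℝ => (p + 1) * ρ ^ ((p - 1) / 2)) atTop (𝓝 0) := by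
  have hb : 0 < -log ρ / 2 := by linarith [log_neg h0 h1]
  have t1 := tendsto_rpow_mul_exp_neg_mul_atTop_nhds_zero 1 _ hb
  have t0 := tendsto_rpow_mul_exp_neg_mul_atTop_nhds_zero 0 _ hb
  have t := (t1.add t0).mul_const (exp (-log ρ / 2))
  rw [add_zero, zero_mul] at t
  refine t.congr fun p => ?_
  rw [rpow_one, rpow_zero, ← add_mul, mul_assoc, ← exp_add, rpow_def_of_pos h0]
  congr 2
  ring

theorem tendsto_mul_three_fourths_rpow :
    Tendsto (fun p : ℝ => p * (3 / 4 : ℝ) ^ p) atTop (𝓝 0) := by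
  have h := log_neg (show (0 : ℝ) < 3 / 4 by norm_num) (by norm_num)
  have hb : 0 < -log (3 / 4 : ℝ) := by linarith
  refine (tendsto_rpow_mul_exp_neg_mul_atTop_nhds_zero 1 _ hb).congr fun p => ?_
  rw [rpow_one, neg_neg, rpow_def_of_pos (by norm_num)]

theorem tendsto_log_div_atTop : Tendsto (fun p : ℝ => log p / p) atTop (𝓝 0) := by
  simpa using tendsto_pow_log_div_mul_add_atTop 1 0 1 one_ne_zero

theorem tendsto_of_add_le {a b e : ℝ → ℝ} {L : ℝ} (ha : ∀ c < L, ∀ᶠ p in atTop, c < a p)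
    (hb : ∀ c < L, ∀ᶠ p in atTop, c < b p) (hab : ∀ᶠ p in atTop, a p + b p ≤ e p)
    (he : Tendsto e atTop (𝓝 (2 * L))) : Tendsto a atTop (𝓝 L) := by
  refine tendsto_order.2 ⟨ha, fun c hc => ?_⟩
  filter_upwards [hb ((3 * L - c) / 2) (by linarith), hab,
    he.eventually_lt_const (show 2 * L < (c + L) / 2 + L by linarith)] with p h1 h2 h3
  linarith

theorem exists_const_gt {c : ℝ} (hc : c < 8 * π * exp 1) :
    ∃ η, 0 < η ∧ η < 1 ∧ c < 2 * exp 1 * (4 * π * (1 - η) / (1 + η)) := by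
  have h : ContinuousAt (fun η : ℝ => 2 * exp 1 * (4 * π * (1 - η) / (1 + η))) 0 := by
    refine continuousAt_const.mul (ContinuousAt.div (by fun_prop) (by fun_prop) (by norm_num))
  have h1 := h.eventually_const_lt (u := c) (by norm_num; linarith)
  have h2 : ∀ᶠ η : ℝ in 𝓝[>] 0, η < 1 :=
    nhdsWithin_le_nhds (gt_mem_nhds one_pos)
  obtain ⟨η, ⟨h3, h4⟩, h5⟩ :=
    ((h1.filter_mono nhdsWithin_le_nhds).and h2 |>.and self_mem_nhdsWithin).exists
  exact ⟨η, h5, h4, h3⟩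

/-- The sharp asymptotic lower bound on the energy of a nodal component. -/
theorem eventually_lt_mul_setIntegral_rpow {Ω : Set R2} (hop : IsOpen Ω)
    (hbdd : Bornology.IsBounded Ω) {u : ℝ → R2 → ℝ} (hsol : ∀ p > (1 : ℝ), IsSolution Ω p (u p))
    (hpos : ∀ p > (1 : ℝ), ∃ x ∈ Ω, 0 < u p x) {c : ℝ} (hc : c < 8 * π * exp 1) :
    ∀ᶠ p : ℝ in atTop, c < p * ∫ x in Ω, max (u p x) 0 ^ (p + 1) := by
  have hπ := pi_pos
  rcases le_or_gt c 0 with hc0 | hc0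
  · filter_upwards [eventually_gt_atTop 1] with p hp
    exact hc0.trans_lt (mul_pos (by linarith) (setIntegral_rpow_pos hop hbdd hp (hsol p hp)
      (hpos p hp)))
  obtain ⟨D, hD, hSD⟩ := exists_forall_subset_ball hbdd
  obtain ⟨η, hη, hη1, hcη⟩ := exists_const_gt hc
  set K : ℝ := 2 * exp 1 * (4 * π * (1 - η) / (1 + η)) with hK
  have hK0 : 0 < K := hc0.trans hcη
  set C : ℝ := moserConst Ω D (1 - η) η with hC
  obtain ⟨ρ, hρ, hρ1⟩ := exists_between (show c / K < 1 by rwa [div_lt_one hK0])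
  have hρ0 : 0 < ρ := (div_pos hc0 hK0).trans hρ
  have t1 : Tendsto (fun p : ℝ => |C| / K * ((p + 1) * ρ ^ ((p - 1) / 2))) atTop (𝓝 0) := by
    simpa using (tendsto_add_one_mul_rpow hρ0 hρ1).const_mul (|C| / K)
  have t2 : Tendsto (fun p : ℝ => c / K * (1 + p⁻¹)) atTop (𝓝 (c / K)) := by
    simpa using (tendsto_inv_atTop_zero.const_add (1 : ℝ)).const_mul (c / K)
  filter_upwards [eventually_gt_atTop 1, t1.eventually_lt_const one_pos,
    t2.eventually_lt_const hρ] with p hp h1 h2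
  by_contra! h3
  have hp0 : 0 < p := by linarith
  have hW := setIntegral_rpow_pos hop hbdd hp (hsol p hp) (hpos p hp)
  have h4 := setIntegral_rpow_le_moserConst hop hbdd hp (hsol p hp) (hpos p hp) hD hSD
    (b := 1 - η) (η := η) (by linarith) (by linarith) hη
  rw [← hK, ← hC] at h4
  set W := ∫ x in Ω, max (u p x) 0 ^ (p + 1)
  set y := (p + 1) * W / K with hy
  have hy0 : 0 < y := by positivity
  have hyρ : y ≤ ρ := by
    refine le_trans ?_ h2.le
    have h5 : W ≤ c / p := by rwa [le_div_iff₀ hp0, mul_comm]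
    calc y ≤ (p + 1) * (c / p) / K := by rw [hy]; gcongr
      _ = c / K * (1 + p⁻¹) := by field_simp
  have h5 : y ^ ((p + 1) / 2) = y * y ^ ((p - 1) / 2) := by
    rw [← rpow_one_add' hy0.le (by linarith)]
    congr 1
    ring
  have h6 : y ^ ((p - 1) / 2) ≤ ρ ^ ((p - 1) / 2) := rpow_le_rpow hy0.le hyρ (by linarith)
  have h7 : W ≤ |C| / K * ((p + 1) * ρ ^ ((p - 1) / 2)) * W := by
    calc W ≤ C * (y * y ^ ((p - 1) / 2)) := by rwa [← h5]
      _ ≤ |C| * (y * ρ ^ ((p - 1) / 2)) := by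
        gcongr
        exact le_abs_self C
      _ = _ := by rw [hy]; ring
  nlinarith

theorem tendsto_of_sq_sub_le {m κ : ℝ → ℝ} {a : ℝ}
    (hm : ∀ᶠ p in atTop, 0 < m p) (hκ : Tendsto κ atTop (𝓝 0))
    (h : ∀ᶠ p in atTop, (m p - a) ^ 2 ≤ κ p * m p ^ 2) : Tendsto m atTop (𝓝 a) := by
  have hs : Tendsto (fun p => √(κ p)) atTop (𝓝 0) := by simpa using hκ.sqrt
  have h1 : Tendsto (fun p => a / (1 + √(κ p))) atTop (𝓝 a) := by
    simpa [Pi.div_def] using (tendsto_const_nhds (x := a)).div (hs.const_add 1) (by simp)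
  have h2 : Tendsto (fun p => a / (1 - √(κ p))) atTop (𝓝 a) := by
    simpa [Pi.div_def] using (tendsto_const_nhds (x := a)).div (hs.const_sub 1) (by simp)
  have key : ∀ᶠ p in atTop, |m p - a| ≤ √(κ p) * m p := by
    filter_upwards [h, hm] with p hp hmp
    have h3 := abs_le_sqrt hp
    rwa [sqrt_mul' _ (sq_nonneg _), sqrt_sq hmp.le] at h3
  refine tendsto_of_tendsto_of_tendsto_of_le_of_le' h1 h2 ?_ ?_
  · filter_upwards [key] with p hp
    rw [div_le_iff₀ (by positivity)]
    linarith [(abs_le.1 hp).1]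
  · filter_upwards [key, hs.eventually_lt_const one_pos] with p hp h3
    rw [le_div_iff₀ (by linarith)]
    linarith [(abs_le.1 hp).2]

/-- The limit of the maximum, from the potential estimates in abstract form. -/
theorem tendsto_sqrt_exp_of_bounds {M P w l r k σ : ℝ → ℝ}
    (hw : Tendsto w atTop (𝓝 (8 * π * exp 1))) (hr : Tendsto r atTop (𝓝 0))
    (hk : Tendsto k atTop (𝓝 0)) (hσ : Tendsto σ atTop (𝓝 0)) (hσ0 : ∀ᶠ p in atTop, 0 ≤ σ p)
    (hM : ∀ᶠ p in atTop, 0 < M p) (hkM : ∀ᶠ p in atTop, k p ≤ log (M p))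
    (hl : ∀ᶠ p in atTop, l p ≤ log (max (M p) 1) + r p)
    (hP : ∀ᶠ p in atTop, P p ^ 2 ≤ w p / (4 * π) * l p)
    (hMP : ∀ᶠ p in atTop, M p - σ p * (1 + l p) ≤ P p) :
    Tendsto M atTop (𝓝 √(exp 1)) := by
  have hπ := pi_pos
  set q : ℝ := √(exp 1) with hq
  have hq2 : q ^ 2 = exp 1 := sq_sqrt (exp_pos 1).le
  have hq1 : 1 < q := by
    rw [hq, lt_sqrt zero_le_one]
    simp
  have hq0 : 0 < q := by linarith
  set S : ℝ → ℝ := fun p => |1 - exp (k p)| + σ p * (1 + |r p|) with hS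
  have hSt : Tendsto S atTop (𝓝 0) := by
    have h1 : Tendsto (fun p => |1 - exp (k p)|) atTop (𝓝 0) := by
      have := ((continuous_exp.tendsto 0).comp hk).const_sub 1 |>.abs
      simpa using this
    simpa using h1.add (hσ.mul (hr.abs.const_add 1))
  have hw' : Tendsto (fun p => w p / (4 * π)) atTop (𝓝 (2 * exp 1)) := by
    convert hw.div_const (4 * π) using 2
    field_simp
    norm_num
  set κ : ℝ → ℝ := fun p => 4 * S p + |w p / (4 * π) - 2 * exp 1| + w p / (4 * π) * |r p| with hκ
  have hκt : Tendsto κ atTop (𝓝 0) := by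
    have h1 : Tendsto (fun p => |w p / (4 * π) - 2 * exp 1|) atTop (𝓝 0) := by
      simpa using (hw'.sub_const (2 * exp 1)).abs
    simpa using ((hSt.const_mul 4).add h1).add (hw'.mul hr.abs)
  have hm : Tendsto (fun p => max (M p) 1) atTop (𝓝 q) := by
    refine tendsto_of_sq_sub_le (.of_forall fun p => lt_max_of_lt_right one_pos) hκt ?_
    filter_upwards [hσ0, hM, hkM, hl, hP, hMP, hw'.eventually_const_lt
      (show 0 < 2 * exp 1 by positivity)] with p h0 h1 h2 h3 h4 h5 h6
    set m := max (M p) 1 with hm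
    have hm1 : 1 ≤ m := le_max_right _ _
    have hm0 : 0 < m := by linarith
    have hmM : m ≤ M p + |1 - exp (k p)| := by
      refine max_le (by linarith [abs_nonneg (1 - exp (k p))]) ?_
      have := (le_log_iff_exp_le h1).1 h2
      linarith [le_abs_self (1 - exp (k p))]
    have hlogm : log m ≤ m - 1 := log_le_sub_one_of_pos hm0
    have hlogm0 : 0 ≤ log m := log_nonneg hm1
    have hr1 := le_abs_self (r p)
    have hr0 := abs_nonneg (r p)
    have hb : m - P p ≤ S p * (1 + m) := by
      have h7 : σ p * (1 + l p) ≤ σ p * (m + |r p|) :=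
        mul_le_mul_of_nonneg_left (by linarith) h0
      have h8 : |1 - exp (k p)| ≤ |1 - exp (k p)| * (1 + m) := by
        nlinarith [abs_nonneg (1 - exp (k p))]
      have h9 : σ p * (m + |r p|) ≤ σ p * (1 + |r p|) * (1 + m) := by
        rw [mul_assoc]
        refine mul_le_mul_of_nonneg_left ?_ h0
        nlinarith
      simp only [hS]
      linarith
    have hS0 : 0 ≤ S p := by
      simp only [hS]
      positivity
    have hsq : m ^ 2 ≤ P p ^ 2 + 4 * S p * m ^ 2 := by
      have h10 : 0 ≤ S p * m ^ 2 := by positivity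
      rcases le_total m (P p) with h | h
      · nlinarith
      · have h7 : m ^ 2 - P p ^ 2 ≤ 2 * m * (m - P p) := by nlinarith [sq_nonneg (m - P p)]
        have h8 : 2 * m * (m - P p) ≤ 2 * m * (S p * (1 + m)) :=
          mul_le_mul_of_nonneg_left hb (by linarith)
        have h9 : 2 * m * (S p * (1 + m)) ≤ 4 * S p * m ^ 2 := by
          have : 0 ≤ S p * m * (m - 1) := by
            have : 0 ≤ m - 1 := by linarith
            positivity
          nlinarith
        linarith
    have hPm : P p ^ 2 ≤ 2 * exp 1 * log m +
        (|w p / (4 * π) - 2 * exp 1| + w p / (4 * π) * |r p|) * m ^ 2 := by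
      have h7 : P p ^ 2 ≤ w p / (4 * π) * (log m + |r p|) :=
        h4.trans (mul_le_mul_of_nonneg_left (by linarith) h6.le)
      have h8 : (w p / (4 * π) - 2 * exp 1) * log m ≤ |w p / (4 * π) - 2 * exp 1| * m ^ 2 := by
        refine mul_le_mul (le_abs_self _) (by nlinarith) hlogm0 (abs_nonneg _)
      have h9 : w p / (4 * π) * |r p| ≤ w p / (4 * π) * |r p| * m ^ 2 :=
        le_mul_of_one_le_right (by positivity) (by nlinarith)
      linarith
    have hlog : 2 * exp 1 * log m ≤ 2 * q * m - q ^ 2 := by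
      have h7 := log_le_sub_one_of_pos (x := m / q) (by positivity)
      rw [log_div hm0.ne' hq0.ne', hq, log_sqrt (exp_pos 1).le, log_exp, ← hq] at h7
      have h8 := mul_le_mul_of_nonneg_left h7 (by positivity : 0 ≤ 2 * q ^ 2)
      have h9 : 2 * q ^ 2 * (m / q - 1) = 2 * q * m - 2 * q ^ 2 := by field_simp
      rw [← hq2]
      linarith
    simp only [hκ]
    linarith
  refine hm.congr' ?_
  filter_upwards [hm.eventually_const_lt hq1] with p hp
  exact max_eq_left ((lt_max_iff.1 hp).resolve_right (lt_irrefl 1)).le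

theorem log_one_add_div_le {p M D : ℝ} (hp : 1 < p) (hM : 0 < M) :
    log (1 + D ^ 2 / (1 / (p ^ 2 * M ^ p))) / p ≤
      log (max M 1) + (log (1 + D ^ 2) + 2 * log p) / p := by
  have hp0 : 0 < p := by linarith
  have hm : 0 < max M 1 := lt_max_of_lt_right one_pos
  have h1 : 1 ≤ p ^ 2 * max M 1 ^ p :=
    one_le_mul_of_one_le_of_one_le (by nlinarith)
      (one_le_rpow (le_max_right _ _) hp0.le)
  have h2 : 1 + D ^ 2 / (1 / (p ^ 2 * M ^ p)) ≤ (1 + D ^ 2) * (p ^ 2 * max M 1 ^ p) := by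
    have h3 : D ^ 2 * (p ^ 2 * M ^ p) ≤ D ^ 2 * (p ^ 2 * max M 1 ^ p) := by
      gcongr
      exact le_max_left _ _
    rw [div_div_eq_mul_div, div_one]
    linarith
  have h4 := log_le_log (by positivity) h2
  rw [log_mul (by positivity) (by positivity), log_mul (by positivity) (by positivity),
    log_pow, log_rpow hm] at h4
  rw [div_le_iff₀ hp0, add_mul, div_mul_cancel₀ _ hp0.ne']
  push_cast at h4
  linarith

theorem le_log_one_add_div {p M D : ℝ} (hp : 1 < p) (hM : 0 < M) (hD : 0 < D) :
    log M + (2 * log D + 2 * log p) / p ≤ log (1 + D ^ 2 / (1 / (p ^ 2 * M ^ p))) / p := by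
  have hp0 : 0 < p := by linarith
  have h2 : D ^ 2 * (p ^ 2 * M ^ p) ≤ 1 + D ^ 2 / (1 / (p ^ 2 * M ^ p)) := by
    rw [div_div_eq_mul_div, div_one]
    linarith
  have h4 := log_le_log (by positivity) h2
  rw [log_mul (by positivity) (by positivity), log_mul (by positivity) (by positivity),
    log_pow, log_pow, log_rpow hM] at h4
  rw [le_div_iff₀ hp0, add_mul, div_mul_cancel₀ _ hp0.ne']
  push_cast at h4
  linarith

theorem tendsto_const_add_mul_log_div (a b : ℝ) :
    Tendsto (fun p : ℝ => (a + b * log p) / p) atTop (𝓝 0) := by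
  have h := (tendsto_inv_atTop_zero.const_mul a).add (tendsto_log_div_atTop.const_mul b)
  rw [mul_zero, mul_zero, add_zero] at h
  exact h.congr fun p => by ring

theorem tendsto_const_sub_log_div_add_one (a : ℝ) :
    Tendsto (fun p : ℝ => (a - log p) / (p + 1)) atTop (𝓝 0) := by
  have h1 : Tendsto (fun p : ℝ => (1 + p⁻¹)⁻¹) atTop (𝓝 1) := by
    simpa using (tendsto_inv_atTop_zero.const_add (1 : ℝ)).inv₀ (by simp)
  have h := (tendsto_const_add_mul_log_div a (-1)).mul h1
  rw [zero_mul] at h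
  refine h.congr' ?_
  filter_upwards [eventually_gt_atTop 0] with p hp
  field_simp
  ring

theorem setIntegral_rpow_le_mul_volume {Ω : Set R2} {p M : ℝ} {u : R2 → ℝ} (hop : IsOpen Ω)
    (hbdd : Bornology.IsBounded Ω) (hp : 1 < p) (hu : IsSolution Ω p u)
    (hM : ∀ x ∈ Ω, max (u x) 0 ≤ M) :
    ∫ x in Ω, max (u x) 0 ^ (p + 1) ≤ M ^ (p + 1) * volume.real Ω := by
  have h := setIntegral_mono_on (hu.integrableOn_rpow hbdd (q := p + 1) (by linarith))
    (integrableOn_const (C := M ^ (p + 1)) hbdd.measure_lt_top.ne) hop.measurableSet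
    fun x hx => rpow_le_rpow (le_max_right _ _) (hM x hx) (by linarith)
  rwa [setIntegral_const, smul_eq_mul, mul_comm] at h

theorem setIntegral_rpow_add_one_le {Ω : Set R2} {p M : ℝ} {u : R2 → ℝ} (hop : IsOpen Ω)
    (hbdd : Bornology.IsBounded Ω) (hp : 1 < p) (hu : IsSolution Ω p u)
    (hM : ∀ x ∈ Ω, max (u x) 0 ≤ M) :
    ∫ x in Ω, max (u x) 0 ^ (p + 1) ≤ (∫ x in Ω, max (u x) 0 ^ p) * M := by
  rw [← integral_mul_const]
  refine setIntegral_mono_on (hu.integrableOn_rpow hbdd (q := p + 1) (by linarith))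
    ((hu.integrableOn_rpow hbdd (q := p) (by linarith)).mul_const M) hop.measurableSet
    fun x hx => ?_
  have h0 : 0 ≤ max (u x) 0 := le_max_right _ _
  rw [rpow_add_one' h0 (by linarith)]
  exact mul_le_mul_of_nonneg_left (hM x hx) (by positivity)

theorem tendsto_one_half_of_bounds {M l : ℝ → ℝ} {a b : ℝ}
    (hM : Tendsto M atTop (𝓝 √(exp 1)))
    (hlow : ∀ᶠ p in atTop, log (M p) + (a + 2 * log p) / p ≤ l p)
    (hup : ∀ᶠ p in atTop, l p ≤ log (max (M p) 1) + (b + 2 * log p) / p) :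
    Tendsto l atTop (𝓝 (1 / 2)) := by
  have hq1 : 1 ≤ √(exp 1) := by
    rw [le_sqrt zero_le_one (exp_pos 1).le]
    simp
  have hlogq : log √(exp 1) = 1 / 2 := by rw [log_sqrt (exp_pos 1).le, log_exp]
  have h1 := ((hM.max (tendsto_const_nhds (x := (1 : ℝ)))).log (by positivity)).add
    (tendsto_const_add_mul_log_div b 2)
  have h2 := (hM.log (by positivity)).add (tendsto_const_add_mul_log_div a 2)
  rw [max_eq_left hq1, hlogq, add_zero] at h1
  rw [hlogq, add_zero] at h2
  exact tendsto_of_tendsto_of_tendsto_of_le_of_le' h2 h1 hlow hup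

/-- The limit of the mass, from the potential estimates in abstract form. -/
theorem tendsto_mass_of_bounds {M P w l σ v ε : ℝ → ℝ} {C : ℝ}
    (hw : Tendsto w atTop (𝓝 (8 * π * exp 1))) (hM : Tendsto M atTop (𝓝 √(exp 1)))
    (hl : Tendsto l atTop (𝓝 (1 / 2))) (hσ : Tendsto σ atTop (𝓝 0))
    (hε : Tendsto ε atTop (𝓝 0))
    (hP : ∀ᶠ p in atTop, P p ^ 2 ≤ w p / (4 * π) * l p)
    (hMP : ∀ᶠ p in atTop, M p - σ p * (1 + l p) ≤ P p)
    (hlow : ∀ᶠ p in atTop, w p / M p ≤ v p)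
    (hup : ∀ᶠ p in atTop, 0 < P p → v p ≤ P p / (l p / (4 * π)) +
      C * √((w p - P p ^ 2 / (l p / (4 * π))) * w p) + ε p) :
    Tendsto v atTop (𝓝 (8 * π * √(exp 1))) := by
  have hπ := pi_pos
  set q : ℝ := √(exp 1) with hq
  have hq0 : 0 < q := sqrt_pos.2 (exp_pos 1)
  have hq2 : q ^ 2 = exp 1 := sq_sqrt (exp_pos 1).le
  have hPt : Tendsto P atTop (𝓝 q) := by
    have h1 : Tendsto (fun p => M p - σ p * (1 + l p)) atTop (𝓝 q) := by
      simpa using hM.sub (hσ.mul (hl.const_add 1))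
    have h2 : Tendsto (fun p => √(w p / (4 * π) * l p)) atTop (𝓝 q) := by
      convert ((hw.div_const (4 * π)).mul hl).sqrt using 2
      rw [hq]
      congr 1
      field_simp
      norm_num
    refine tendsto_of_tendsto_of_tendsto_of_le_of_le' h1 h2 hMP ?_
    filter_upwards [hP] with p hp using le_sqrt_of_sq_le hp
  have hnt : Tendsto (fun p => l p / (4 * π)) atTop (𝓝 (1 / (8 * π))) := by
    convert hl.div_const (4 * π) using 2
    field_simp
    norm_num
  have hn0 : 1 / (8 * π) ≠ 0 := by positivity
  have hlow' : Tendsto (fun p => w p / M p) atTop (𝓝 (8 * π * q)) := by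
    have h := hw.div hM hq0.ne'
    rwa [← hq2, show 8 * π * q ^ 2 / q = 8 * π * q by field_simp] at h
  have hup' : Tendsto (fun p => P p / (l p / (4 * π)) +
      C * √((w p - P p ^ 2 / (l p / (4 * π))) * w p) + ε p) atTop (𝓝 (8 * π * q)) := by
    have h := ((hPt.div hnt hn0).add
      ((((hw.sub ((hPt.pow 2).div hnt hn0)).mul hw).sqrt).const_mul C)).add hε
    have h0 : 8 * π * exp 1 - q ^ 2 / (1 / (8 * π)) = 0 := by
      rw [hq2]
      field_simp
      ring
    rwa [h0, zero_mul, sqrt_zero, mul_zero, add_zero, add_zero,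
      show q / (1 / (8 * π)) = 8 * π * q by field_simp] at h
  refine tendsto_of_tendsto_of_tendsto_of_le_of_le' hlow' hup' hlow ?_
  filter_upwards [hup, hPt.eventually_const_lt hq0] with p h1 h2 using h1 h2

/-- The asymptotics of a nodal component with minimal energy: its maximum tends to `√e` and
`p ∫ (u⁺)^p` tends to `8π√e`. -/
theorem tendsto_max_and_mul_setIntegral_rpow {Ω : Set R2} (hop : IsOpen Ω)
    (hbdd : Bornology.IsBounded Ω) {u : ℝ → R2 → ℝ} (hsol : ∀ p > (1 : ℝ), IsSolution Ω p (u p))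
    (hpos : ∀ p > (1 : ℝ), ∃ x ∈ Ω, 0 < u p x) {x₀ : ℝ → R2} (hx₀ : ∀ p > (1 : ℝ), x₀ p ∈ Ω)
    (hmax : ∀ p > (1 : ℝ), ∀ x ∈ Ω, u p x ≤ u p (x₀ p))
    (hw : Tendsto (fun p => p * ∫ x in Ω, max (u p x) 0 ^ (p + 1)) atTop
      (𝓝 (8 * π * exp 1))) :
    Tendsto (fun p => u p (x₀ p)) atTop (𝓝 √(exp 1)) ∧
      Tendsto (fun p => p * ∫ x in Ω, max (u p x) 0 ^ p) atTop (𝓝 (8 * π * √(exp 1))) := by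
  have hπ := pi_pos
  obtain ⟨D, hD, hSD⟩ := exists_forall_subset_ball hbdd
  obtain ⟨C, -, hC⟩ := exists_abs_deriv_cut_le (show (0 : ℝ) < 1 / 4 by norm_num)
  obtain ⟨M, hMdef⟩ : ∃ M : ℝ → ℝ, ∀ p, u p (x₀ p) = M p := ⟨_, fun _ => rfl⟩
  obtain ⟨s, hsdef⟩ : ∃ s : ℝ → ℝ, ∀ p, s p = 1 / (p ^ 2 * M p ^ p) := ⟨_, fun _ => rfl⟩
  obtain ⟨l, hldef⟩ : ∃ l : ℝ → ℝ, ∀ p, l p = log (1 + D ^ 2 / s p) / p := ⟨_, fun _ => rfl⟩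
  obtain ⟨P, hPdef⟩ : ∃ P : ℝ → ℝ, ∀ p, potPair Ω (1 / p) (s p) (u p) (x₀ p) = P p :=
    ⟨_, fun _ => rfl⟩
  simp only [hMdef] at hmax ⊢
  have hMpos : ∀ p > (1 : ℝ), 0 < M p := fun p hp =>
    let ⟨x, hx, h⟩ := hpos p hp
    h.trans_le (hmax p hp x hx)
  have hMle : ∀ p > (1 : ℝ), ∀ x ∈ Ω, max (u p x) 0 ≤ M p := fun p hp x hx =>
    max_le (hmax p hp x hx) (hMpos p hp).le
  have hspos : ∀ p > (1 : ℝ), 0 < s p := fun p hp => by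
    have := hMpos p hp
    have : 0 < p := by linarith
    rw [hsdef]
    positivity
  have hlp : ∀ p > (1 : ℝ), log (1 + D ^ 2 / s p) = p * l p := fun p hp => by
    rw [hldef, mul_div_cancel₀ _ (by linarith)]
  have hlpos : ∀ p > (1 : ℝ), 0 < l p := fun p hp => by
    have : 0 < D ^ 2 / s p := div_pos (by positivity) (hspos p hp)
    rw [hldef]
    exact div_pos (log_pos (by linarith)) (by linarith)
  have hlup : ∀ p > (1 : ℝ), l p ≤ log (max (M p) 1) + (log (1 + D ^ 2) + 2 * log p) / p :=
    fun p hp => by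
      rw [hldef, hsdef]
      exact log_one_add_div_le hp (hMpos p hp)
  have hllow : ∀ p > (1 : ℝ), log (M p) + (2 * log D + 2 * log p) / p ≤ l p := fun p hp => by
    rw [hldef, hsdef]
    exact le_log_one_add_div hp (hMpos p hp) hD
  have hPsq : ∀ p > (1 : ℝ),
      P p ^ 2 ≤ (p * ∫ x in Ω, max (u p x) 0 ^ (p + 1)) / (4 * π) * l p := fun p hp => by
    have h := potPair_sq_le hop hbdd hp (hsol p hp) (δ := 1 / p) (by positivity) hD hSD
      (hx₀ p hp) (hspos p hp)
    rw [hPdef, hlp p hp] at h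
    exact h.trans_eq (by ring)
  have hMP : ∀ p > (1 : ℝ), M p - 3 / p * (1 + l p) ≤ P p := fun p hp => by
    have hp0 : 0 < p := by linarith
    have hMp := hMpos p hp
    have hl := hlpos p hp
    have h := le_potPair hop hbdd (hsol p hp) (δ := 1 / p) (by positivity) hD hSD (hx₀ p hp)
      (hspos p hp) (A := M p ^ p) fun x hx =>
        rpow_le_rpow (le_max_right _ _) (hMle p hp x hx) hp0.le
    rw [hMdef, max_eq_left hMp.le, hPdef, hlp p hp] at h
    have h1 : M p ^ p * (s p / 4 * (1 + p * l p)) = (1 + p * l p) / (4 * p ^ 2) := by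
      rw [hsdef]
      field_simp
    have h2 : (1 + p * l p) / (4 * p ^ 2) ≤ (1 + l p) / p := by
      rw [div_le_div_iff₀ (by positivity) hp0]
      have h3 : 0 ≤ l p * p ^ 2 := by positivity
      nlinarith
    have h3 : 0 ≤ 2 * (1 / p) * l p := by positivity
    have h4 : 3 / p * (1 + l p) = 2 * (1 / p) + 2 * (1 / p) * l p + (1 + l p) / p := by ring
    linarith
  have hvol : 0 < volume.real Ω := by
    obtain ⟨x, hx, -⟩ := hpos 2 (by norm_num)
    exact ENNReal.toReal_pos (hop.measure_pos _ ⟨x, hx⟩).ne' hbdd.measure_lt_top.ne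
  have hgt := eventually_gt_atTop (1 : ℝ)
  have hσ : Tendsto (fun p : ℝ => 3 / p) atTop (𝓝 0) := tendsto_const_nhds.div_atTop tendsto_id
  have hMt : Tendsto M atTop (𝓝 √(exp 1)) := by
    refine tendsto_sqrt_exp_of_bounds hw
      (tendsto_const_add_mul_log_div (log (1 + D ^ 2)) 2)
      (tendsto_const_sub_log_div_add_one (log (1 / volume.real Ω))) hσ ?_ (hgt.mono hMpos) ?_
      (hgt.mono hlup) (hgt.mono hPsq) (hgt.mono hMP)
    · filter_upwards [hgt] with p hp
      positivity
    · filter_upwards [hgt, hw.eventually_const_lt (u := 1)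
        (by nlinarith [pi_gt_three, add_one_le_exp (1 : ℝ)])] with p hp h1
      have hp0 : 0 < p := by linarith
      have hMp := hMpos p hp
      have h2 := setIntegral_rpow_le_mul_volume hop hbdd hp (hsol p hp) (hMle p hp)
      have h3 : 1 / volume.real Ω / p ≤ M p ^ (p + 1) := by
        rw [div_div, div_le_iff₀ (by positivity)]
        nlinarith
      have h4 := log_le_log (by positivity) h3
      rw [log_div (by positivity) hp0.ne', log_rpow hMp] at h4
      rw [div_le_iff₀ (by linarith)]
      linarith
  refine ⟨hMt, tendsto_mass_of_bounds (C := C) hw hMt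
    (tendsto_one_half_of_bounds hMt (hgt.mono hllow) (hgt.mono hlup)) hσ
    (by simpa using tendsto_mul_three_fourths_rpow.mul_const (volume.real Ω))
    (hgt.mono hPsq) (hgt.mono hMP) ?_ ?_⟩
  · filter_upwards [hgt] with p hp
    have h := setIntegral_rpow_add_one_le hop hbdd hp (hsol p hp) (hMle p hp)
    rw [div_le_iff₀ (hMpos p hp), mul_assoc]
    exact mul_le_mul_of_nonneg_left h (by linarith)
  · filter_upwards [eventually_ge_atTop 8] with p hp8 hP
    have hp : 1 < p := by linarith
    have hp0 : 0 < p := by linarith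
    have hl := hlpos p hp
    have h := setIntegral_rpow_le_potPair hop hbdd hp (hsol p hp) (δ := 1 / p)
      (by positivity) (one_div_le_one_div_of_le (by norm_num) hp8) hD hSD (hx₀ p hp)
      (hspos p hp) hC (N := p * (l p / (4 * π))) (by rw [hlp p hp]; ring)
      (by rw [hPdef]; exact hP.le)
    rw [hPdef] at h
    refine (mul_le_mul_of_nonneg_left h hp0.le).trans_eq ?_
    generalize ∫ x in Ω, max (u p x) 0 ^ (p + 1) = W
    have h2 : (p * W - P p ^ 2 / (l p / (4 * π))) * (p * W) =
        p ^ 2 * ((W - P p ^ 2 / (p * (l p / (4 * π)))) * W) := by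
      field_simp
    rw [h2, sqrt_mul (sq_nonneg p), sqrt_sq hp0.le]
    field_simp

theorem stmt18
    (Ω : Set R2) (hne : Ω.Nonempty) (hop : IsOpen Ω)
    (hbdd : Bornology.IsBounded Ω) (hconn : IsConnected Ω) (hsm : SmoothBoundary Ω)
    (u : ℝ → R2 → ℝ)
    (hsol : ∀ p > (1:ℝ), IsSolution Ω p (u p))
    (hnod : ∀ p > (1:ℝ), IsNodal Ω (u p))
    (xp xm : ℝ → R2)
    (hxpmem : ∀ p > (1:ℝ), xp p ∈ Ω)
    (hxpmax : ∀ p > (1:ℝ), ∀ x ∈ Ω, u p x ≤ u p (xp p))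
    (hxmmem : ∀ p > (1:ℝ), xm p ∈ Ω)
    (hxmmin : ∀ p > (1:ℝ), ∀ x ∈ Ω, u p (xm p) ≤ u p x)
    (hcomp : ∀ p > (1:ℝ), -u p (xm p) ≤ u p (xp p))
    (hA : CondA Ω u) (hB : CondB u xp xm) (hM : MorseOne Ω u) :
    Tendsto (fun p : ℝ => p * (∫ x in Ω, max (u p x) 0 ^ (p + 1)) / u p (xp p) ^ 2)
      atTop (𝓝 (8 * π)) ∧
    Tendsto (fun p : ℝ => p * (∫ x in Ω, max (-u p x) 0 ^ (p + 1)) / u p (xp p) ^ 2)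
      atTop (𝓝 (8 * π)) ∧
    Tendsto (fun p : ℝ => p * (∫ x in Ω, max (u p x) 0 ^ p) / u p (xp p))
      atTop (𝓝 (8 * π)) ∧
    Tendsto (fun p : ℝ => p * (∫ x in Ω, max (-u p x) 0 ^ p) / u p (xp p))
      atTop (𝓝 (8 * π)) := by
  have hπ := pi_pos
  have hgt := eventually_gt_atTop (1 : ℝ)
  have hsol' : ∀ p > (1 : ℝ), IsSolution Ω p (fun x => -u p x) := fun p hp => (hsol p hp).neg
  have hpos : ∀ p > (1 : ℝ), ∃ x ∈ Ω, 0 < u p x := fun p hp => (hnod p hp).1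
  have hpos' : ∀ p > (1 : ℝ), ∃ x ∈ Ω, 0 < -u p x := fun p hp =>
    let ⟨x, hx, h⟩ := (hnod p hp).2
    ⟨x, hx, neg_pos.2 h⟩
  have hE : Tendsto (fun p : ℝ => p * ∫ x in Ω, ‖gradient (u p) x‖ ^ 2) atTop
      (𝓝 (2 * (8 * π * exp 1))) := by
    rwa [show 2 * (8 * π * exp 1) = 16 * π * exp 1 by ring]
  have hsum : ∀ᶠ p in atTop, p * (∫ x in Ω, max (u p x) 0 ^ (p + 1)) +
      p * (∫ x in Ω, max (-u p x) 0 ^ (p + 1)) ≤ p * ∫ x in Ω, ‖gradient (u p) x‖ ^ 2 := by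
    filter_upwards [hgt, hE.eventually_const_lt (u := 0) (by positivity)] with p hp h
    have hint : IntegrableOn (fun x => ‖gradient (u p) x‖ ^ 2) Ω :=
      not_not.1 fun hn => by simp [integral_undef hn] at h
    rw [← mul_add]
    exact mul_le_mul_of_nonneg_left (setIntegral_rpow_add_le hop hbdd hp (hsol p hp) hint)
      (by linarith)
  have hlow := fun c hc => eventually_lt_mul_setIntegral_rpow hop hbdd hsol hpos (c := c) hc
  have hlow' := fun c hc => eventually_lt_mul_setIntegral_rpow hop hbdd hsol' hpos' (c := c) hc
  have hw := tendsto_of_add_le hlow hlow' hsum hE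
  have hw' := tendsto_of_add_le hlow' hlow (hsum.mono fun p h => by rwa [add_comm]) hE
  obtain ⟨hmax, hv⟩ :=
    tendsto_max_and_mul_setIntegral_rpow hop hbdd hsol hpos hxpmem hxpmax hw
  obtain ⟨-, hv'⟩ := tendsto_max_and_mul_setIntegral_rpow hop hbdd hsol' hpos' hxmmem
    (fun p hp x hx => neg_le_neg (hxmmin p hp x hx)) hw'
  have hq0 : √(exp 1) ≠ 0 := (sqrt_pos.2 (exp_pos 1)).ne'
  have hdiv : ∀ {f : ℝ → ℝ}, Tendsto f atTop (𝓝 (8 * π * exp 1)) →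
      Tendsto (fun p => f p / u p (xp p) ^ 2) atTop (𝓝 (8 * π)) := fun hf => by
    have h := hf.div (hmax.pow 2) (pow_ne_zero 2 hq0)
    rwa [sq_sqrt (exp_pos 1).le, mul_div_cancel_right₀ _ (exp_pos 1).ne'] at h
  have hdiv' : ∀ {f : ℝ → ℝ}, Tendsto f atTop (𝓝 (8 * π * √(exp 1))) →
      Tendsto (fun p => f p / u p (xp p)) atTop (𝓝 (8 * π)) := fun hf => by
    have h := hf.div hmax hq0
    rwa [mul_div_cancel_right₀ _ hq0] at h
  exact ⟨hdiv hw, hdiv hw', hdiv' hv, hdiv' hv'⟩
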